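/- arXiv:2001.08054 — 6 statements merged into one kernel-verified Lean document; each statement's English description precedes it below -/
import Mathlib

section
/- For every 3-periodic billiard orbit P₁P₂P₃ in the ellipse E, the ratio of inradius to circumradius is the same and equals r/R = 2(δ − b²)(a² − δ)/(a² − b²)². -/
noncomputable section

open EuclideanGeometry Real

/-- Points of the plane. -/
abbrev Pt := EuclideanSpace ℝ (Fin 2)

/-- Membership in the billiard ellipse `x²/a² + y²/b² = 1`. -/
def onEllipse (a b : ℝ) (P : Pt) : Prop :=
  (P 0) ^ 2 / a ^ 2 + (P 1) ^ 2 / b ^ 2 = 1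

/-- Billiard reflection law at vertex `P` (other vertices `Q`, `R`): the sum of the two
unit vectors from `P` towards `Q` and `R` is orthogonal to the tangent direction
`(-P.y/b², P.x/a²)` of the ellipse at `P`. -/
def reflects (a b : ℝ) (P Q R : Pt) : Prop :=
  (‖Q - P‖⁻¹ • (Q - P) + ‖R - P‖⁻¹ • (R - P)) 0 * (-(P 1) / b ^ 2) +
  (‖Q - P‖⁻¹ • (Q - P) + ‖R - P‖⁻¹ • (R - P)) 1 * ((P 0) / a ^ 2) = 0

/-- `P₁P₂P₃` is a 3-periodic billiard orbit in the ellipse with semiaxes `a`, `b`: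
pairwise distinct points on the ellipse satisfying the reflection law at every vertex. -/
def IsOrbit (a b : ℝ) (P₁ P₂ P₃ : Pt) : Prop :=
  P₁ ≠ P₂ ∧ P₂ ≠ P₃ ∧ P₁ ≠ P₃ ∧
  onEllipse a b P₁ ∧ onEllipse a b P₂ ∧ onEllipse a b P₃ ∧
  reflects a b P₁ P₂ P₃ ∧ reflects a b P₂ P₃ P₁ ∧ reflects a b P₃ P₁ P₂

lemma aux_chord (z1 z2 w1 w2 α β : ℂ) (h1 : z1 * w1 = 1) (h2 : z2 * w2 = 1) (hne : z1 ≠ z2)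
    (h : ((z1 - z2) * (w1 - w2)) ^ 2 = α * (z1 - z2 + (w1 - w2)) ^ 2
      - β * (z1 - z2 - (w1 - w2)) ^ 2) :
    (z1 - z2) ^ 2 = α * (z1 * z2 - 1) ^ 2 - β * (z1 * z2 + 1) ^ 2 := by
  have hz1 : z1 ≠ 0 := left_ne_zero_of_mul_eq_one h1
  have hz2 : z2 ≠ 0 := left_ne_zero_of_mul_eq_one h2
  have e1 : w1 = 1 / z1 := by field_simp; linear_combination h1
  have e2 : w2 = 1 / z2 := by field_simp; linear_combination h2
  have hd : (z1 - z2) ^ 2 ≠ 0 := pow_ne_zero _ (sub_ne_zero.2 hne)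
  subst e1 e2
  field_simp at h
  apply mul_left_cancel₀ hd
  linear_combination h

lemma aux_two (z1 z2 z3 w1 w2 w3 α β : ℂ) (h1 : z1 * w1 = 1) (h2 : z2 * w2 = 1)
    (h3 : z3 * w3 = 1) (n12 : z1 ≠ z2) (n13 : z1 ≠ z3) (n23 : z2 ≠ z3)
    (h12 : ((z1 - z2) * (w1 - w2)) ^ 2 = α * (z1 - z2 + (w1 - w2)) ^ 2
      - β * (z1 - z2 - (w1 - w2)) ^ 2)
    (h13 : ((z1 - z3) * (w1 - w3)) ^ 2 = α * (z1 - z3 + (w1 - w3)) ^ 2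
      - β * (z1 - z3 - (w1 - w3)) ^ 2)
    (h23 : ((z2 - z3) * (w2 - w3)) ^ 2 = α * (z2 - z3 + (w2 - w3)) ^ 2
      - β * (z2 - z3 - (w2 - w3)) ^ 2) :
    (α - β) * (z1 * z2 + z1 * z3 + z2 * z3) + 2 * (2 - α - β) = 1 ∧
    z1 + z2 + z3 = -(α - β) * (z1 * z2 * z3) := by
  have c12 := aux_chord z1 z2 w1 w2 α β h1 h2 n12 h12
  have c13 := aux_chord z1 z3 w1 w3 α β h1 h3 n13 h13
  have c23 := aux_chord z2 z3 w2 w3 α β h2 h3 n23 h23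
  have q1 : 2 * z1 + z2 + z3 = (α - β) * z1 ^ 2 * (z2 + z3) + 2 * (2 - α - β) * z1 := by
    apply mul_left_cancel₀ (sub_ne_zero.2 n23)
    linear_combination c12 - c13
  have q2 : 2 * z2 + z1 + z3 = (α - β) * z2 ^ 2 * (z1 + z3) + 2 * (2 - α - β) * z2 := by
    apply mul_left_cancel₀ (sub_ne_zero.2 n13)
    linear_combination c12 - c23
  have r : (α - β) * (z1 * z2 + z1 * z3 + z2 * z3) + 2 * (2 - α - β) = 1 := by
    apply mul_left_cancel₀ (sub_ne_zero.2 n12)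
    linear_combination q2 - q1
  refine ⟨r, ?_⟩
  linear_combination q1 + z1 * r

lemma aux_real (X1 Y1 X2 Y2 X3 Y3 α β : ℝ) (h1 : X1 ^ 2 + Y1 ^ 2 = 1) (h2 : X2 ^ 2 + Y2 ^ 2 = 1)
    (h3 : X3 ^ 2 + Y3 ^ 2 = 1)
    (n12 : ¬ (X1 = X2 ∧ Y1 = Y2)) (n13 : ¬ (X1 = X3 ∧ Y1 = Y3)) (n23 : ¬ (X2 = X3 ∧ Y2 = Y3))
    (h12 : ((X1 - X2) ^ 2 + (Y1 - Y2) ^ 2) ^ 2 = 4 * (α * (X1 - X2) ^ 2 + β * (Y1 - Y2) ^ 2))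
    (h13 : ((X1 - X3) ^ 2 + (Y1 - Y3) ^ 2) ^ 2 = 4 * (α * (X1 - X3) ^ 2 + β * (Y1 - Y3) ^ 2))
    (h23 : ((X2 - X3) ^ 2 + (Y2 - Y3) ^ 2) ^ 2 = 4 * (α * (X2 - X3) ^ 2 + β * (Y2 - Y3) ^ 2)) :
    2 * (2 - α - β) = 1 + (α - β) ^ 2 ∧
    (X1 + X2 + X3) ^ 2 + (Y1 + Y2 + Y3) ^ 2 = (α - β) ^ 2 := by
  have I2 := Complex.I_sq
  have key : ∀ X Y : ℝ, X ^ 2 + Y ^ 2 = 1 →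
      ((X : ℂ) + Y * Complex.I) * ((X : ℂ) - Y * Complex.I) = 1 := by
    intro X Y h
    have : (X : ℂ) ^ 2 + (Y : ℂ) ^ 2 = 1 := by exact_mod_cast h
    linear_combination this - (Y : ℂ) ^ 2 * I2
  have ne : ∀ X Y X' Y' : ℝ, ¬ (X = X' ∧ Y = Y') →
      ((X : ℂ) + Y * Complex.I) ≠ ((X' : ℂ) + Y' * Complex.I) := by
    intro X Y X' Y' h e
    apply h
    constructor
    · simpa using congrArg Complex.re e
    · simpa using congrArg Complex.im e
  have ne' : ∀ X Y X' Y' : ℝ, ¬ (X = X' ∧ Y = Y') →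
      ((X : ℂ) - Y * Complex.I) ≠ ((X' : ℂ) - Y' * Complex.I) := by
    intro X Y X' Y' h e
    apply h
    constructor
    · simpa using congrArg Complex.re e
    · simpa using congrArg Complex.im e
  have ch : ∀ X Y X' Y' : ℝ,
      ((X - X') ^ 2 + (Y - Y') ^ 2) ^ 2 = 4 * (α * (X - X') ^ 2 + β * (Y - Y') ^ 2) →
      ((((X : ℂ) + Y * Complex.I) - ((X' : ℂ) + Y' * Complex.I)) *
       (((X : ℂ) - Y * Complex.I) - ((X' : ℂ) - Y' * Complex.I))) ^ 2 =
       (α : ℂ) * (((X : ℂ) + Y * Complex.I) - ((X' : ℂ) + Y' * Complex.I) +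
       (((X : ℂ) - Y * Complex.I) - ((X' : ℂ) - Y' * Complex.I))) ^ 2 -
       (β : ℂ) * (((X : ℂ) + Y * Complex.I) - ((X' : ℂ) + Y' * Complex.I) -
       (((X : ℂ) - Y * Complex.I) - ((X' : ℂ) - Y' * Complex.I))) ^ 2 := by
    intro X Y X' Y' h
    have hc : (((X : ℂ) - X') ^ 2 + ((Y : ℂ) - Y') ^ 2) ^ 2
      = 4 * (α * ((X : ℂ) - X') ^ 2 + β * ((Y : ℂ) - Y') ^ 2) := by exact_mod_cast h
    have e1 : ((((X : ℂ) + Y * Complex.I) - ((X' : ℂ) + Y' * Complex.I)) *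
       (((X : ℂ) - Y * Complex.I) - ((X' : ℂ) - Y' * Complex.I))) =
       ((X : ℂ) - X') ^ 2 + ((Y : ℂ) - Y') ^ 2 := by
      linear_combination -((Y : ℂ) - Y') ^ 2 * I2
    rw [e1]
    linear_combination hc + 4 * β * ((Y : ℂ) - Y') ^ 2 * I2
  have ch' : ∀ X Y X' Y' : ℝ,
      ((X - X') ^ 2 + (Y - Y') ^ 2) ^ 2 = 4 * (α * (X - X') ^ 2 + β * (Y - Y') ^ 2) →
      ((((X : ℂ) - Y * Complex.I) - ((X' : ℂ) - Y' * Complex.I)) *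
       (((X : ℂ) + Y * Complex.I) - ((X' : ℂ) + Y' * Complex.I))) ^ 2 =
       (α : ℂ) * (((X : ℂ) - Y * Complex.I) - ((X' : ℂ) - Y' * Complex.I) +
       (((X : ℂ) + Y * Complex.I) - ((X' : ℂ) + Y' * Complex.I))) ^ 2 -
       (β : ℂ) * (((X : ℂ) - Y * Complex.I) - ((X' : ℂ) - Y' * Complex.I) -
       (((X : ℂ) + Y * Complex.I) - ((X' : ℂ) + Y' * Complex.I))) ^ 2 := by
    intro X Y X' Y' h
    linear_combination ch X Y X' Y' h
  have k1 := key _ _ h1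
  have k2 := key _ _ h2
  have k3 := key _ _ h3
  obtain ⟨p, q⟩ := aux_two _ _ _ _ _ _ (α : ℂ) (β : ℂ) k1 k2 k3
    (ne _ _ _ _ n12) (ne _ _ _ _ n13) (ne _ _ _ _ n23) (ch _ _ _ _ h12) (ch _ _ _ _ h13)
    (ch _ _ _ _ h23)
  obtain ⟨-, q'⟩ := aux_two _ _ _ _ _ _ (α : ℂ) (β : ℂ) ((mul_comm _ _).trans k1)
    ((mul_comm _ _).trans k2) ((mul_comm _ _).trans k3)
    (ne' _ _ _ _ n12) (ne' _ _ _ _ n13) (ne' _ _ _ _ n23) (ch' _ _ _ _ h12) (ch' _ _ _ _ h13)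
    (ch' _ _ _ _ h23)
  have m : ((X1 : ℂ) + X2 + X3) ^ 2 + ((Y1 : ℂ) + Y2 + Y3) ^ 2 =
    ((X1 : ℂ) + Y1 * Complex.I + (X2 + Y2 * Complex.I) + (X3 + Y3 * Complex.I)) *
    ((X1 : ℂ) - Y1 * Complex.I + (X2 - Y2 * Complex.I) + (X3 - Y3 * Complex.I)) := by
    linear_combination ((Y1 : ℂ) + Y2 + Y3) ^ 2 * I2
  generalize (X1 : ℂ) + Y1 * Complex.I = z1 at *
  generalize (X2 : ℂ) + Y2 * Complex.I = z2 at *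
  generalize (X3 : ℂ) + Y3 * Complex.I = z3 at *
  generalize (X1 : ℂ) - Y1 * Complex.I = w1 at *
  generalize (X2 : ℂ) - Y2 * Complex.I = w2 at *
  generalize (X3 : ℂ) - Y3 * Complex.I = w3 at *
  have P : (z1 * z2 * z3) * (w1 * w2 * w3) = 1 := by
    calc _ = (z1 * w1) * (z2 * w2) * (z3 * w3) := by ring
      _ = 1 := by rw [k1, k2, k3]; ring
  have e2 : z1 * z2 + z1 * z3 + z2 * z3 = -((α : ℂ) - β) := by
    linear_combination z1 * z2 * z3 * q' - (α - β) * P - z2 * z3 * k1 - z1 * z3 * k2 - z1 * z2 * k3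
  constructor
  · have : 2 * (2 - (α : ℂ) - β) = 1 + ((α : ℂ) - β) ^ 2 := by
      linear_combination p - (α - β) * e2
    exact_mod_cast this
  · have : ((X1 : ℂ) + X2 + X3) ^ 2 + ((Y1 : ℂ) + Y2 + Y3) ^ 2 = ((α : ℂ) - β) ^ 2 := by
      rw [m, q, q']
      linear_combination (α - β) ^ 2 * P
    exact_mod_cast this

/-- Joachimsthal from reflection. -/
lemma aux_joach (u0 u1 v0 v1 n0 n1 s t d e : ℝ) (hs : 0 < s) (ht : 0 < t)
    (hs2 : s ^ 2 = u0 ^ 2 + u1 ^ 2) (ht2 : t ^ 2 = v0 ^ 2 + v1 ^ 2)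
    (h : (s⁻¹ * u0 + t⁻¹ * v0) * (-n1) + (s⁻¹ * u1 + t⁻¹ * v1) * n0 = 0)
    (hd : u0 * n0 + u1 * n1 = -d) (he : v0 * n0 + v1 * n1 = -e) (d0 : 0 < d) (e0 : 0 < e) :
    d * t = e * s := by
  have h' : t * (u1 * n0 - u0 * n1) = - (s * (v1 * n0 - v0 * n1)) := by
    field_simp at h
    linear_combination h
  have sq : (d * t) ^ 2 = (e * s) ^ 2 := by
    have hd' : d = -(u0 * n0 + u1 * n1) := by linarith
    have he' : e = -(v0 * n0 + v1 * n1) := by linarith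
    have h2 : (t * (u1 * n0 - u0 * n1)) ^ 2 = (s * (v1 * n0 - v0 * n1)) ^ 2 := by
      rw [h']; ring
    have a1 : d ^ 2 = s ^ 2 * (n0 ^ 2 + n1 ^ 2) - (u1 * n0 - u0 * n1) ^ 2 := by
      rw [hs2, hd']; ring
    have a2 : e ^ 2 = t ^ 2 * (n0 ^ 2 + n1 ^ 2) - (v1 * n0 - v0 * n1) ^ 2 := by
      rw [ht2, he']; ring
    rw [mul_pow, mul_pow, a1, a2]
    linear_combination -h2
  exact (pow_left_inj₀ (by positivity) (by positivity) two_ne_zero).1 sq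

set_option maxHeartbeats 1000000 in
lemma aux_final (a b X1 Y1 X2 Y2 X3 Y3 s1 s2 s3 : ℝ) (hb : 0 < b) (hab : b < a)
    (h1 : X1 ^ 2 + Y1 ^ 2 = 1) (h2 : X2 ^ 2 + Y2 ^ 2 = 1) (h3 : X3 ^ 2 + Y3 ^ 2 = 1)
    (p1 : 0 < s1) (p2 : 0 < s2) (p3 : 0 < s3)
    (q1 : s1 ^ 2 = a ^ 2 * (X3 - X2) ^ 2 + b ^ 2 * (Y3 - Y2) ^ 2)
    (q2 : s2 ^ 2 = a ^ 2 * (X1 - X3) ^ 2 + b ^ 2 * (Y1 - Y3) ^ 2)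
    (q3 : s3 ^ 2 = a ^ 2 * (X2 - X1) ^ 2 + b ^ 2 * (Y2 - Y1) ^ 2)
    (j1 : (s3⁻¹ * (a * (X2 - X1)) + s2⁻¹ * (a * (X3 - X1))) * (-(Y1 / b)) +
      (s3⁻¹ * (b * (Y2 - Y1)) + s2⁻¹ * (b * (Y3 - Y1))) * (X1 / a) = 0)
    (j2 : (s1⁻¹ * (a * (X3 - X2)) + s3⁻¹ * (a * (X1 - X2))) * (-(Y2 / b)) +
      (s1⁻¹ * (b * (Y3 - Y2)) + s3⁻¹ * (b * (Y1 - Y2))) * (X2 / a) = 0) :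
    8 * (|a * (X2 - X1) * (b * (Y3 - Y1)) - b * (Y2 - Y1) * (a * (X3 - X1))| / 2) ^ 2 /
      ((s1 + s2 + s3) * (s1 * s2 * s3)) =
      2 * (√(a ^ 4 - a ^ 2 * b ^ 2 + b ^ 4) - b ^ 2) *
        (a ^ 2 - √(a ^ 4 - a ^ 2 * b ^ 2 + b ^ 4)) / (a ^ 2 - b ^ 2) ^ 2 := by
  have ha : 0 < a := hb.trans hab
  have n12 : ¬ (X1 = X2 ∧ Y1 = Y2) := by
    rintro ⟨rfl, rfl⟩; have := pow_pos p3 2; rw [q3] at this; simp at this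
  have n13 : ¬ (X1 = X3 ∧ Y1 = Y3) := by
    rintro ⟨rfl, rfl⟩; have := pow_pos p2 2; rw [q2] at this; simp at this
  have n23 : ¬ (X2 = X3 ∧ Y2 = Y3) := by
    rintro ⟨rfl, rfl⟩; have := pow_pos p1 2; rw [q1] at this; simp at this
  have pos : ∀ X Y X' Y' : ℝ, X ^ 2 + Y ^ 2 = 1 → X' ^ 2 + Y' ^ 2 = 1 → ¬ (X = X' ∧ Y = Y') →
      0 < 1 - (X * X' + Y * Y') := by
    intro X Y X' Y' e e' n
    have hh : (X - X') ^ 2 + (Y - Y') ^ 2 = 2 * (1 - (X * X' + Y * Y')) := by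
      linear_combination e + e'
    by_contra hc
    have hx := sq_nonneg (X - X')
    have hy := sq_nonneg (Y - Y')
    apply n
    constructor
    · exact sub_eq_zero.1 (pow_eq_zero_iff two_ne_zero |>.1 (by linarith : (X - X') ^ 2 = 0))
    · exact sub_eq_zero.1 (pow_eq_zero_iff two_ne_zero |>.1 (by linarith : (Y - Y') ^ 2 = 0))
  obtain ⟨D1, hD1⟩ : ∃ D, D = 1 - (X2 * X3 + Y2 * Y3) := ⟨_, rfl⟩
  obtain ⟨D2, hD2⟩ : ∃ D, D = 1 - (X1 * X3 + Y1 * Y3) := ⟨_, rfl⟩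
  obtain ⟨D3, hD3⟩ : ∃ D, D = 1 - (X1 * X2 + Y1 * Y2) := ⟨_, rfl⟩
  have d1 : 0 < D1 := hD1 ▸ pos _ _ _ _ h2 h3 n23
  have d2 : 0 < D2 := hD2 ▸ pos _ _ _ _ h1 h3 n13
  have d3 : 0 < D3 := hD3 ▸ pos _ _ _ _ h1 h2 n12
  have J1 : D3 * s2 = D2 * s3 := by
    refine aux_joach _ _ _ _ (X1 / a) (Y1 / b) s3 s2 D3 D2 p3 p2 ?_ ?_ j1 ?_ ?_ d3 d2
    · rw [q3]; ring
    · rw [q2]; ring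
    · field_simp; rw [hD3]; linear_combination -h1
    · field_simp; rw [hD2]; linear_combination -h1
  have J2 : D1 * s3 = D3 * s1 := by
    refine aux_joach _ _ _ _ (X2 / a) (Y2 / b) s1 s3 D1 D3 p1 p3 ?_ ?_ j2 ?_ ?_ d1 d3
    · rw [q1]; ring
    · rw [q3]; ring
    · field_simp; rw [hD1]; linear_combination -h2
    · field_simp; rw [hD3]; linear_combination -h2
  obtain ⟨J, hJ⟩ : ∃ J, J = D3 / s3 := ⟨_, rfl⟩
  have Jpos : 0 < J := hJ ▸ div_pos d3 p3
  have E3 : D3 = J * s3 := by rw [hJ]; field_simp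
  have E2 : D2 = J * s2 := by rw [hJ]; field_simp; linarith
  have E1 : D1 = J * s1 := by rw [hJ]; field_simp; linarith
  have F1 : D1 ^ 2 = J ^ 2 * s1 ^ 2 := by rw [E1]; ring
  have F2 : D2 ^ 2 = J ^ 2 * s2 ^ 2 := by rw [E2]; ring
  have F3 : D3 ^ 2 = J ^ 2 * s3 ^ 2 := by rw [E3]; ring
  have G1 : (X2 - X3) ^ 2 + (Y2 - Y3) ^ 2 = 2 * D1 := by rw [hD1]; linear_combination h2 + h3
  have G2 : (X1 - X3) ^ 2 + (Y1 - Y3) ^ 2 = 2 * D2 := by rw [hD2]; linear_combination h1 + h3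
  have G3 : (X1 - X2) ^ 2 + (Y1 - Y2) ^ 2 = 2 * D3 := by rw [hD3]; linear_combination h1 + h2
  obtain ⟨T, N⟩ := aux_real X1 Y1 X2 Y2 X3 Y3 (J ^ 2 * a ^ 2) (J ^ 2 * b ^ 2) h1 h2 h3 n12 n13 n23
    (by rw [G3]; linear_combination 4 * F3 + 4 * J ^ 2 * q3)
    (by rw [G2]; linear_combination 4 * F2 + 4 * J ^ 2 * q2)
    (by rw [G1]; linear_combination 4 * F1 + 4 * J ^ 2 * q1)
  have S : J * (s1 + s2 + s3) = (9 - (J ^ 2 * a ^ 2 - J ^ 2 * b ^ 2) ^ 2) / 2 := by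
    have : D1 + D2 + D3 = (9 - (J ^ 2 * a ^ 2 - J ^ 2 * b ^ 2) ^ 2) / 2 := by
      rw [← N, hD1, hD2, hD3]; linear_combination (1/2) * (h1 + h2 + h3)
    rw [← this, E1, E2, E3]; ring
  have Ar : ((X2 - X1) * (Y3 - Y1) - (Y2 - Y1) * (X3 - X1)) ^ 2 = 2 * (D1 * D2 * D3) := by
    rw [hD1, hD2, hD3]
    have e1 : Y1 ^ 2 = 1 - X1 ^ 2 := by linarith
    have e2 : Y2 ^ 2 = 1 - X2 ^ 2 := by linarith
    have e3 : Y3 ^ 2 = 1 - X3 ^ 2 := by linarith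
    ring_nf
    simp only [e1, e2, e3]
    ring
  have Hδ : J ^ 2 * (a ^ 2 - b ^ 2) ^ 2 + (a ^ 2 + b ^ 2) =
      2 * √(a ^ 4 - a ^ 2 * b ^ 2 + b ^ 4) := by
    have : √(a ^ 4 - a ^ 2 * b ^ 2 + b ^ 4) =
        (J ^ 2 * (a ^ 2 - b ^ 2) ^ 2 + (a ^ 2 + b ^ 2)) / 2 := by
      rw [Real.sqrt_eq_iff_mul_self_eq_of_pos (by positivity)]
      linear_combination (-1/4) * (a ^ 2 - b ^ 2) ^ 2 * T
    rw [this]; ring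
  have Hd : √(a ^ 4 - a ^ 2 * b ^ 2 + b ^ 4) =
      (J ^ 2 * (a ^ 2 - b ^ 2) ^ 2 + (a ^ 2 + b ^ 2)) / 2 := by linarith
  have c0 : a ^ 2 - b ^ 2 ≠ 0 := (sub_pos.2 (pow_lt_pow_left₀ hab hb.le two_ne_zero)).ne'
  have R1 : 2 * (√(a ^ 4 - a ^ 2 * b ^ 2 + b ^ 4) - b ^ 2) *
        (a ^ 2 - √(a ^ 4 - a ^ 2 * b ^ 2 + b ^ 4)) / (a ^ 2 - b ^ 2) ^ 2
      = (1 - (J ^ 2 * a ^ 2 - J ^ 2 * b ^ 2) ^ 2) / 2 := by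
    rw [Hd]; field_simp; ring
  rw [R1, div_pow, sq_abs]
  have Ar2 : (a * (X2 - X1) * (b * (Y3 - Y1)) - b * (Y2 - Y1) * (a * (X3 - X1))) ^ 2 =
      a ^ 2 * b ^ 2 * (2 * (J ^ 3 * (s1 * s2 * s3))) := by
    have : J ^ 3 * (s1 * s2 * s3) = D1 * D2 * D3 := by rw [E1, E2, E3]; ring
    rw [this, ← Ar]; ring
  rw [Ar2, div_eq_iff (by positivity)]
  have fin : 4 * (a ^ 2 * b ^ 2 * J ^ 4) = (1 - (J ^ 2 * a ^ 2 - J ^ 2 * b ^ 2) ^ 2) / 2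
      * (J * (s1 + s2 + s3)) := by
    rw [S]
    have T' : J ^ 2 * a ^ 2 + J ^ 2 * b ^ 2 = (3 - (J ^ 2 * a ^ 2 - J ^ 2 * b ^ 2) ^ 2) / 2 := by
      linarith
    have : 4 * (a ^ 2 * b ^ 2 * J ^ 4) = (J ^ 2 * a ^ 2 + J ^ 2 * b ^ 2) ^ 2
      - (J ^ 2 * a ^ 2 - J ^ 2 * b ^ 2) ^ 2 := by ring
    rw [this, T']; ring
  apply mul_left_cancel₀ Jpos.ne'
  linear_combination (s1 * s2 * s3) * fin

/-- The inradius-to-circumradius ratio is invariant over the 3-periodic family. -/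
theorem inradius_circumradius_ratio (a b : ℝ) (hb : 0 < b) (hab : b < a)
    (P₁ P₂ P₃ : Pt) (h : IsOrbit a b P₁ P₂ P₃) :
    let s₁ := ‖P₃ - P₂‖
    let s₂ := ‖P₁ - P₃‖
    let s₃ := ‖P₂ - P₁‖
    let L := s₁ + s₂ + s₃
    let A := |((P₂ - P₁) 0) * ((P₃ - P₁) 1) - ((P₂ - P₁) 1) * ((P₃ - P₁) 0)| / 2
    let r := 2 * A / L
    let R := s₁ * s₂ * s₃ / (4 * A)
    let δ := Real.sqrt (a ^ 4 - a ^ 2 * b ^ 2 + b ^ 4)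
    r / R = 2 * (δ - b ^ 2) * (a ^ 2 - δ) / (a ^ 2 - b ^ 2) ^ 2 := by
  intro s₁ s₂ s₃ L A r R δ
  obtain ⟨n12, n23, n13, o1, o2, o3, r1, r2, -⟩ := h
  have ha : 0 < a := hb.trans hab
  have p1 : 0 < s₁ := norm_pos_iff.2 (sub_ne_zero.2 n23.symm)
  have p2 : 0 < s₂ := norm_pos_iff.2 (sub_ne_zero.2 n13)
  have p3 : 0 < s₃ := norm_pos_iff.2 (sub_ne_zero.2 n12.symm)
  have nsq : ∀ P Q : Pt, ‖P - Q‖ ^ 2 = a ^ 2 * (P 0 / a - Q 0 / a) ^ 2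
      + b ^ 2 * (P 1 / b - Q 1 / b) ^ 2 := by
    intro P Q
    rw [EuclideanSpace.norm_sq_eq]
    simp only [Fin.sum_univ_two, Real.norm_eq_abs, sq_abs, PiLp.sub_apply]
    field_simp
  have hr : r / R = 8 * A ^ 2 / ((s₁ + s₂ + s₃) * (s₁ * s₂ * s₃)) := by
    simp only [r, R, L]
    rw [div_div_div_eq]
    congr 1; ring
  unfold onEllipse at o1 o2 o3
  unfold reflects at r1 r2
  rw [norm_sub_rev P₃ P₁] at r1
  rw [norm_sub_rev P₁ P₂] at r2
  simp only [PiLp.add_apply, PiLp.smul_apply, PiLp.sub_apply, smul_eq_mul] at r1 r2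
  have key := aux_final a b (P₁ 0 / a) (P₁ 1 / b) (P₂ 0 / a) (P₂ 1 / b) (P₃ 0 / a) (P₃ 1 / b)
    s₁ s₂ s₃ hb hab (by rw [div_pow, div_pow, o1]) (by rw [div_pow, div_pow, o2])
    (by rw [div_pow, div_pow, o3]) p1 p2 p3 (nsq _ _) (nsq _ _) (nsq _ _)
    (by
      rw [← r1]
      simp only [s₂, s₃]
      field_simp)
    (by
      rw [← r2]
      simp only [s₁, s₃]
      field_simp)
  rw [hr]
  simp only [δ]
  rw [← key]
  simp only [A, PiLp.sub_apply]
  have c : ∀ x y : ℝ, a * (x / a - y / a) = x - y := by intro x y; field_simp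
  have c' : ∀ x y : ℝ, b * (x / b - y / b) = x - y := by intro x y; field_simp
  simp only [c, c']
end
end

section
/- For every 3-periodic billiard orbit P₁P₂P₃ in the ellipse E, the sum of the cosines of the interior angles is the same and equals cos θ₁ + cos θ₂ + cos θ₃ = 1 + 2(δ − b²)(a² − δ)/(a² − b²)². -/
noncomputable section

open EuclideanGeometry Real

lemma aux_unit (n1 n2 p1 p2 u1 u2 v1 v2 J K : ℝ) (hnp : n1 * p1 + n2 * p2 = 1)
    (hu : u1 ^ 2 + u2 ^ 2 = 1) (hv : v1 ^ 2 + v2 ^ 2 = 1)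
    (hJ : n1 * u1 + n2 * u2 = -J) (hK : n1 * v1 + n2 * v2 = -K) (hJp : 0 < J) (hKp : 0 < K)
    (ht : (u1 + v1) * (-n2) + (u2 + v2) * n1 = 0) :
    J = K ∧ u1 * v1 + u2 * v2 = -1 - J * ((u1 + v1) * p1 + (u2 + v2) * p2) := by
  have hn : n1 ^ 2 + n2 ^ 2 ≠ 0 := by
    intro h0
    have h1 : n1 = 0 := by nlinarith [sq_nonneg n1, sq_nonneg n2]
    have h2 : n2 = 0 := by nlinarith [sq_nonneg n1, sq_nonneg n2]
    simp [h1, h2] at hnp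
  have hJK : J = K := by
    have e1 : J ^ 2 + (u2 * n1 - u1 * n2) ^ 2 = n1 ^ 2 + n2 ^ 2 := by
      have : J = -(n1 * u1 + n2 * u2) := by linarith
      rw [this]; linear_combination (n1 ^ 2 + n2 ^ 2) * hu
    have e2 : K ^ 2 + (v2 * n1 - v1 * n2) ^ 2 = n1 ^ 2 + n2 ^ 2 := by
      have : K = -(n1 * v1 + n2 * v2) := by linarith
      rw [this]; linear_combination (n1 ^ 2 + n2 ^ 2) * hv
    have e3 : u2 * n1 - u1 * n2 = -(v2 * n1 - v1 * n2) := by linarith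
    rw [e3] at e1
    have : J ^ 2 = K ^ 2 := by linarith
    exact (pow_left_inj₀ hJp.le hKp.le two_ne_zero).1 this
  refine ⟨hJK, ?_⟩
  subst hJK
  obtain ⟨S1, hS1⟩ : ∃ S, S = u1 + v1 := ⟨_, rfl⟩
  obtain ⟨S2, hS2⟩ : ∃ S, S = u2 + v2 := ⟨_, rfl⟩
  rw [← hS1, ← hS2] at ht ⊢
  have hSn : n1 * S1 + n2 * S2 = -2 * J := by rw [hS1, hS2]; linarith
  have g1 : (n1 ^ 2 + n2 ^ 2) * S1 = -2 * J * n1 := by linear_combination n1 * hSn - n2 * ht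
  have g2 : (n1 ^ 2 + n2 ^ 2) * S2 = -2 * J * n2 := by linear_combination n2 * hSn + n1 * ht
  have g3 : S1 ^ 2 + S2 ^ 2 = 2 + 2 * (u1 * v1 + u2 * v2) := by
    rw [hS1, hS2]; linear_combination hu + hv
  have g4 : (n1 ^ 2 + n2 ^ 2) * (S1 ^ 2 + S2 ^ 2) = 4 * J ^ 2 := by
    linear_combination S1 * g1 + S2 * g2 - 2 * J * hSn
  have g5 : (n1 ^ 2 + n2 ^ 2) * (S1 * p1 + S2 * p2) = -2 * J := by
    linear_combination p1 * g1 + p2 * g2 - 2 * J * hnp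
  apply mul_left_cancel₀ hn
  rw [g3] at g4
  linear_combination g4 / 2 + J * g5

/-- distinct points on the unit circle -/
lemma aux_lt (x y z w : ℝ) (h1 : x ^ 2 + y ^ 2 = 1) (h2 : z ^ 2 + w ^ 2 = 1)
    (h : ¬ (x = z ∧ y = w)) : 0 < 1 - (x * z + y * w) := by
  by_contra hc
  apply h
  constructor <;> nlinarith [sq_nonneg (x - z), sq_nonneg (y - w)]

lemma aux_vertex (a b x y x' y' x'' y'' L M : ℝ) (ha : 0 < a) (hb : 0 < b)
    (h0 : x ^ 2 + y ^ 2 = 1) (h1 : x' ^ 2 + y' ^ 2 = 1) (h2 : x'' ^ 2 + y'' ^ 2 = 1)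
    (d1 : ¬ (x = x' ∧ y = y')) (d2 : ¬ (x = x'' ∧ y = y''))
    (hL : 0 < L) (hM : 0 < M)
    (eL : L ^ 2 = (a * x' - a * x) ^ 2 + (b * y' - b * y) ^ 2)
    (eM : M ^ 2 = (a * x'' - a * x) ^ 2 + (b * y'' - b * y) ^ 2)
    (ht : (L⁻¹ * (a * x' - a * x) + M⁻¹ * (a * x'' - a * x)) * (-(b * y) / b ^ 2)
      + (L⁻¹ * (b * y' - b * y) + M⁻¹ * (b * y'' - b * y)) * ((a * x) / a ^ 2) = 0) :
    (1 - (x * x' + y * y')) / L = (1 - (x * x'' + y * y'')) / M ∧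
    ((a * x' - a * x) * (a * x'' - a * x) + (b * y' - b * y) * (b * y'' - b * y)) / (L * M)
     = -1 - (1 - (x * x' + y * y')) / L *
      ((L⁻¹ * (a * x' - a * x) + M⁻¹ * (a * x'' - a * x)) * (a * x)
      + (L⁻¹ * (b * y' - b * y) + M⁻¹ * (b * y'' - b * y)) * (b * y)) := by
  have p1 := aux_lt _ _ _ _ h0 h1 d1
  have p2 := aux_lt _ _ _ _ h0 h2 d2
  have key := aux_unit (x / a) (y / b) (a * x) (b * y) (L⁻¹ * (a * x' - a * x))
    (L⁻¹ * (b * y' - b * y)) (M⁻¹ * (a * x'' - a * x)) (M⁻¹ * (b * y'' - b * y))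
    ((1 - (x * x' + y * y')) / L) ((1 - (x * x'' + y * y'')) / M)
    (by field_simp; linarith)
    (by field_simp; linarith)
    (by field_simp; linarith)
    (by field_simp; linarith)
    (by field_simp; linarith)
    (by positivity) (by positivity)
    (by rw [← ht]; field_simp)
  refine ⟨key.1, ?_⟩
  rw [← key.2]
  field_simp

lemma aux_chord_s4 (a b x y x' y' L J : ℝ)
    (h0 : x ^ 2 + y ^ 2 = 1) (h1 : x' ^ 2 + y' ^ 2 = 1)
    (d1 : ¬ (x = x' ∧ y = y'))
    (eL : L ^ 2 = (a * x' - a * x) ^ 2 + (b * y' - b * y) ^ 2)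
    (hJ : 1 - (x * x' + y * y') = J * L) :
    (1 - J ^ 2 * (a ^ 2 - b ^ 2)) * x * x' + (1 + J ^ 2 * (a ^ 2 - b ^ 2)) * y * y'
      = 1 - J ^ 2 * (a ^ 2 + b ^ 2) := by
  have p1 := aux_lt _ _ _ _ h0 h1 d1
  have e1 : (1 - (x * x' + y * y')) ^ 2 = J ^ 2 * L ^ 2 := by rw [hJ]; ring
  rw [eL] at e1
  have e2 : (x' - x) ^ 2 = (1 - (x * x' + y * y')) * (1 - (x * x' - y * y')) := by
    grind
  have e3 : (y' - y) ^ 2 = (1 - (x * x' + y * y')) * (1 + (x * x' - y * y')) := by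
    grind
  apply mul_left_cancel₀ p1.ne'
  linear_combination (-1) * e1 - J ^ 2 * a ^ 2 * e2 - J ^ 2 * b ^ 2 * e3

/-- third pair, given the polar line of the first vertex -/
lemma aux_pair (p q r x y x' y' x'' y'' : ℝ)
    (h0 : x ^ 2 + y ^ 2 = 1) (h1 : x' ^ 2 + y' ^ 2 = 1) (h2 : x'' ^ 2 + y'' ^ 2 = 1)
    (d : ¬ (x' = x'' ∧ y' = y''))
    (c1 : p * x * x' + q * y * y' = r) (c2 : p * x * x'' + q * y * y'' = r)
    (c3 : p * x' * x'' + q * y' * y'' = r) :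
    r ^ 2 * (p + q) = p ^ 2 * (r + q) * x ^ 2 + q ^ 2 * (r + p) * y ^ 2 ∧
    (p ^ 2 * x ^ 2 + q ^ 2 * y ^ 2) * (x * x' + y * y' + (x * x'' + y * y'') + (x' * x'' + y' * y''))
      = 2 * r ^ 2 + 2 * r * (p * x ^ 2 + q * y ^ 2) - (p ^ 2 * x ^ 2 + q ^ 2 * y ^ 2) := by
  have cr : p * x * (y' + y'') - q * y * (x' + x'') = 0 := by
    have k1 : (x' - x'') * (p * x * (y' + y'') - q * y * (x' + x'')) = 0 := by grind
    have k2 : (y' - y'') * (p * x * (y' + y'') - q * y * (x' + x'')) = 0 := by grind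
    rcases mul_eq_zero.1 k1 with k | k
    · rcases mul_eq_zero.1 k2 with k' | k'
      · exact absurd ⟨by linarith, by linarith⟩ d
      · exact k'
    · exact k
  have s1 : (p ^ 2 * x ^ 2 + q ^ 2 * y ^ 2) * (x' + x'') = 2 * r * (p * x) := by
    linear_combination p * x * (c1 + c2) - q * y * cr
  have s2 : (p ^ 2 * x ^ 2 + q ^ 2 * y ^ 2) * (y' + y'') = 2 * r * (q * y) := by
    linear_combination q * y * (c1 + c2) + p * x * cr
  have m1 : (p ^ 2 * x ^ 2 + q ^ 2 * y ^ 2) * (x' * x'') = r ^ 2 - q ^ 2 * y ^ 2 := by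
    linear_combination x' * s1 + (r - p * x * x' + q * y * y') * c1 - q ^ 2 * y ^ 2 * h1
  have m2 : (p ^ 2 * x ^ 2 + q ^ 2 * y ^ 2) * (y' * y'') = r ^ 2 - p ^ 2 * x ^ 2 := by
    linear_combination y' * s2 + (r - q * y * y' + p * x * x') * c1 - p ^ 2 * x ^ 2 * h1
  constructor
  · linear_combination (p ^ 2 * x ^ 2 + q ^ 2 * y ^ 2) * c3 - p * m1 - q * m2
  · linear_combination x * s1 + y * s2 + m1 + m2

lemma aux_core (p q r x y x' y' x'' y'' : ℝ) (hpq : p + q = 2) (hq : 1 < q) (hpr : p ≠ r)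
    (h0 : x ^ 2 + y ^ 2 = 1) (h1 : x' ^ 2 + y' ^ 2 = 1) (h2 : x'' ^ 2 + y'' ^ 2 = 1)
    (d1 : ¬ (x = x' ∧ y = y')) (d2 : ¬ (x = x'' ∧ y = y'')) (d3 : ¬ (x' = x'' ∧ y' = y''))
    (c1 : p * x * x' + q * y * y' = r) (c2 : p * x * x'' + q * y * y'' = r)
    (c3 : p * x' * x'' + q * y' * y'' = r) :
    p * q + 2 * r = 0 ∧
    (x * x' + y * y' + (x * x'' + y * y'') + (x' * x'' + y' * y'')) = r - 1 := by
  obtain ⟨f1, g1⟩ := aux_pair p q r x y x' y' x'' y'' h0 h1 h2 d3 c1 c2 c3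
  obtain ⟨f2, -⟩ := aux_pair p q r x' y' x y x'' y'' h1 h0 h2 d2 (by linarith) c3 c2
  obtain ⟨f3, -⟩ := aux_pair p q r x'' y'' x y x' y' h2 h0 h1 d1 (by linarith) (by linarith) c1
  have hp : p = 2 - q := by linarith
  have main : p * q + 2 * r = 0 := by
    by_contra hne
    have hcoef : p ^ 2 * (r + q) - q ^ 2 * (r + p) ≠ 0 := by
      have : p ^ 2 * (r + q) - q ^ 2 * (r + p) = (p - q) * (p * q + 2 * r) := by
        rw [← hpq]; ring
      rw [this]
      exact mul_ne_zero (by linarith) hne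
    have a1 : x ^ 2 = x' ^ 2 := by
      apply mul_left_cancel₀ hcoef
      linear_combination f2 - f1 - q ^ 2 * (r + p) * (h0 - h1)
    have a2 : x ^ 2 = x'' ^ 2 := by
      apply mul_left_cancel₀ hcoef
      linear_combination f3 - f1 - q ^ 2 * (r + p) * (h0 - h2)
    have b1 : y ^ 2 = y' ^ 2 := by linarith
    have b2 : y ^ 2 = y'' ^ 2 := by linarith
    have hy : y ≠ 0 ∨ y = 0 := by tauto
    have hq0 : q ≠ 0 := by linarith
    rcases sq_eq_sq_iff_eq_or_eq_neg.1 a1 with a1 | a1 <;>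
    rcases sq_eq_sq_iff_eq_or_eq_neg.1 a2 with a2 | a2 <;>
    rcases sq_eq_sq_iff_eq_or_eq_neg.1 b1 with b1 | b1 <;>
    rcases sq_eq_sq_iff_eq_or_eq_neg.1 b2 with b2 | b2 <;>
    grind
  refine ⟨main, ?_⟩
  have hN : p ^ 2 * x ^ 2 + q ^ 2 * y ^ 2 ≠ 0 := by
    intro hN
    have hy : (q * y) ^ 2 = 0 := by nlinarith [sq_nonneg (p * x), sq_nonneg (q * y)]
    have hx : (p * x) ^ 2 = 0 := by nlinarith [sq_nonneg (p * x), sq_nonneg (q * y)]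
    have hq0 : q ≠ 0 := by linarith
    simp [hq0] at hy hx
    subst hy
    have hr : r = 0 := by
      rcases hx with h | h <;> rw [h] at c1 <;> linarith
    rcases hx with h | h
    · exact hpr (by rw [h, hr])
    · simp [h] at h0
  apply mul_left_cancel₀ hN
  rw [g1]
  have hr : r = -(p * q) / 2 := by linarith
  subst hr
  subst hp
  linear_combination (-(2 - q) ^ 2 * q ^ 2 / 2) * h0

lemma aux_norm (P Q : Pt) : ‖Q - P‖ ^ 2 = (Q 0 - P 0) ^ 2 + (Q 1 - P 1) ^ 2 := by
  rw [EuclideanSpace.norm_sq_eq]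
  simp [Fin.sum_univ_two]

lemma aux_cos (P Q R : Pt) : Real.cos (EuclideanGeometry.angle Q P R) =
    ((Q 0 - P 0) * (R 0 - P 0) + (Q 1 - P 1) * (R 1 - P 1)) / (‖Q - P‖ * ‖R - P‖) := by
  unfold EuclideanGeometry.angle
  rw [InnerProductGeometry.cos_angle]
  simp [PiLp.inner_apply, Fin.sum_univ_two]
  ring

lemma aux_final_s4 (a b x1 y1 x2 y2 x3 y3 L12 L13 L23 δ : ℝ) (hb : 0 < b) (hab : b < a)
    (o1' : x1 ^ 2 + y1 ^ 2 = 1) (o2' : x2 ^ 2 + y2 ^ 2 = 1) (o3' : x3 ^ 2 + y3 ^ 2 = 1)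
    (d12 : ¬ (x1 = x2 ∧ y1 = y2)) (d13 : ¬ (x1 = x3 ∧ y1 = y3)) (d23 : ¬ (x2 = x3 ∧ y2 = y3))
    (l12 : 0 < L12) (l13 : 0 < L13) (l23 : 0 < L23)
    (e12 : L12 ^ 2 = (a * x2 - a * x1) ^ 2 + (b * y2 - b * y1) ^ 2)
    (e13 : L13 ^ 2 = (a * x3 - a * x1) ^ 2 + (b * y3 - b * y1) ^ 2)
    (e23 : L23 ^ 2 = (a * x3 - a * x2) ^ 2 + (b * y3 - b * y2) ^ 2)
    (r1 : (L12⁻¹ * (a * x2 - a * x1) + L13⁻¹ * (a * x3 - a * x1)) * (-(b * y1) / b ^ 2)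
      + (L12⁻¹ * (b * y2 - b * y1) + L13⁻¹ * (b * y3 - b * y1)) * ((a * x1) / a ^ 2) = 0)
    (r2 : (L23⁻¹ * (a * x3 - a * x2) + L12⁻¹ * (a * x1 - a * x2)) * (-(b * y2) / b ^ 2)
      + (L23⁻¹ * (b * y3 - b * y2) + L12⁻¹ * (b * y1 - b * y2)) * ((a * x2) / a ^ 2) = 0)
    (r3 : (L13⁻¹ * (a * x1 - a * x3) + L23⁻¹ * (a * x2 - a * x3)) * (-(b * y3) / b ^ 2)
      + (L13⁻¹ * (b * y1 - b * y3) + L23⁻¹ * (b * y2 - b * y3)) * ((a * x3) / a ^ 2) = 0)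
    (hδ : 0 ≤ δ) (hδ2 : δ ^ 2 = a ^ 4 - a ^ 2 * b ^ 2 + b ^ 4) :
    ((a * x2 - a * x1) * (a * x3 - a * x1) + (b * y2 - b * y1) * (b * y3 - b * y1)) / (L12 * L13) +
    ((a * x1 - a * x2) * (a * x3 - a * x2) + (b * y1 - b * y2) * (b * y3 - b * y2)) / (L12 * L23) +
    ((a * x1 - a * x3) * (a * x2 - a * x3) + (b * y1 - b * y3) * (b * y2 - b * y3)) / (L13 * L23) =
      1 + 2 * (δ - b ^ 2) * (a ^ 2 - δ) / (a ^ 2 - b ^ 2) ^ 2 := by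
  have ha : 0 < a := hb.trans hab
  obtain ⟨j1, v1⟩ := aux_vertex a b x1 y1 x2 y2 x3 y3 L12 L13 ha hb o1' o2' o3' d12 d13 l12 l13
    e12 e13 r1
  obtain ⟨j2, v2⟩ := aux_vertex a b x2 y2 x1 y1 x3 y3 L12 L23 ha hb o2' o1' o3' (by tauto) d23
    l12 l23 (by rw [e12]; ring) e23 (by rw [← r2]; ring)
  obtain ⟨j3, v3⟩ := aux_vertex a b x3 y3 x1 y1 x2 y2 L13 L23 ha hb o3' o1' o2' (by tauto)
    (by tauto) l13 l23 (by rw [e13]; ring) (by rw [e23]; ring) r3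
  rw [v1, v2, v3]
  obtain ⟨J, hJ⟩ : ∃ J, J = (1 - (x1 * x2 + y1 * y2)) / L12 := ⟨_, rfl⟩
  have hJ1 : (1 - (x2 * x1 + y2 * y1)) / L12 = J := by rw [hJ]; ring
  have hJ2 : (1 - (x3 * x1 + y3 * y1)) / L13 = J := by rw [hJ, j1]; ring
  have hJ3 : (1 - (x2 * x3 + y2 * y3)) / L23 = J := by rw [← j2, hJ1]
  rw [← hJ, hJ1, hJ2]
  have hJp : 0 < J := by rw [hJ]; exact div_pos (aux_lt _ _ _ _ o1' o2' d12) l12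
  have k12 : 1 - (x1 * x2 + y1 * y2) = J * L12 := by rw [hJ]; field_simp
  have k13 : 1 - (x1 * x3 + y1 * y3) = J * L13 := by rw [← hJ2]; field_simp
  have k23 : 1 - (x2 * x3 + y2 * y3) = J * L23 := by rw [← hJ3]; field_simp
  have c12 := aux_chord_s4 a b x1 y1 x2 y2 L12 J o1' o2' d12 e12 k12
  have c13 := aux_chord_s4 a b x1 y1 x3 y3 L13 J o1' o3' d13 e13 k13
  have c23 := aux_chord_s4 a b x2 y2 x3 y3 L23 J o2' o3' d23 e23 k23
  have hc : 0 < a ^ 2 - b ^ 2 := sub_pos.2 (pow_lt_pow_left₀ hab hb.le two_ne_zero)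
  have hJ2p : 0 < J ^ 2 := by positivity
  obtain ⟨m1, m2⟩ := aux_core _ _ _ x1 y1 x2 y2 x3 y3 (by ring)
    (by linarith [mul_pos hJ2p hc])
    (by intro hh; linarith [mul_pos hJ2p (pow_pos hb 2)]) o1' o2' o3' d12 d13 d23 c12 c13 c23
  have i12 : L12⁻¹ * ((a * x2 - a * x1) ^ 2 + (b * y2 - b * y1) ^ 2) = L12 := by
    rw [← e12]; field_simp
  have i13 : L13⁻¹ * ((a * x3 - a * x1) ^ 2 + (b * y3 - b * y1) ^ 2) = L13 := by
    rw [← e13]; field_simp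
  have i23 : L23⁻¹ * ((a * x3 - a * x2) ^ 2 + (b * y3 - b * y2) ^ 2) = L23 := by
    rw [← e23]; field_simp
  have hk : J ^ 2 * (a ^ 2 - b ^ 2) ^ 2 + (a ^ 2 + b ^ 2) = 2 * δ := by
    have : (J ^ 2 * (a ^ 2 - b ^ 2) ^ 2 + (a ^ 2 + b ^ 2)) ^ 2 = (2 * δ) ^ 2 := by
      linear_combination (-(a ^ 2 - b ^ 2) ^ 2) * m1 - 4 * hδ2
    exact (pow_left_inj₀ (by positivity) (by positivity) two_ne_zero).1 this
  have hfin : J ^ 2 * (a ^ 2 + b ^ 2) =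
      1 + 2 * (δ - b ^ 2) * (a ^ 2 - δ) / (a ^ 2 - b ^ 2) ^ 2 := by
    field_simp
    linear_combination (a ^ 2 + b ^ 2) * hk + 2 * hδ2
  rw [← hfin]
  linear_combination J * (i12 + i13 + i23) - k12 - k13 - k23 - m2

/-- The sum of the cosines of the orbit's interior angles is invariant. -/
theorem sum_cosines_invariant (a b : ℝ) (hb : 0 < b) (hab : b < a)
    (P₁ P₂ P₃ : Pt) (h : IsOrbit a b P₁ P₂ P₃) :
    let δ := Real.sqrt (a ^ 4 - a ^ 2 * b ^ 2 + b ^ 4)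
    Real.cos (EuclideanGeometry.angle P₂ P₁ P₃) +
      Real.cos (EuclideanGeometry.angle P₁ P₂ P₃) +
      Real.cos (EuclideanGeometry.angle P₁ P₃ P₂) =
      1 + 2 * (δ - b ^ 2) * (a ^ 2 - δ) / (a ^ 2 - b ^ 2) ^ 2 := by
  intro δ
  have hδ : 0 ≤ δ := Real.sqrt_nonneg _
  have hδ2 : δ ^ 2 = a ^ 4 - a ^ 2 * b ^ 2 + b ^ 4 := Real.sq_sqrt (by
    nlinarith [sq_nonneg (a ^ 2 - b ^ 2), sq_nonneg (a * b)])
  clear_value δ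
  obtain ⟨n12, n23, n13, o1, o2, o3, r1, r2, r3⟩ := h
  have ha : 0 < a := hb.trans hab
  obtain ⟨x1, hx1⟩ : ∃ x, P₁ 0 = a * x := ⟨P₁ 0 / a, by field_simp⟩
  obtain ⟨x2, hx2⟩ : ∃ x, P₂ 0 = a * x := ⟨P₂ 0 / a, by field_simp⟩
  obtain ⟨x3, hx3⟩ : ∃ x, P₃ 0 = a * x := ⟨P₃ 0 / a, by field_simp⟩
  obtain ⟨y1, hy1⟩ : ∃ x, P₁ 1 = b * x := ⟨P₁ 1 / b, by field_simp⟩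
  obtain ⟨y2, hy2⟩ : ∃ x, P₂ 1 = b * x := ⟨P₂ 1 / b, by field_simp⟩
  obtain ⟨y3, hy3⟩ : ∃ x, P₃ 1 = b * x := ⟨P₃ 1 / b, by field_simp⟩
  have d12 : ¬ (x1 = x2 ∧ y1 = y2) := by
    rintro ⟨h1, h2⟩
    apply n12; ext i; fin_cases i
    · simp [hx1, hx2, h1]
    · simp [hy1, hy2, h2]
  have d23 : ¬ (x2 = x3 ∧ y2 = y3) := by
    rintro ⟨h1, h2⟩
    apply n23; ext i; fin_cases i
    · simp [hx2, hx3, h1]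
    · simp [hy2, hy3, h2]
  have d13 : ¬ (x1 = x3 ∧ y1 = y3) := by
    rintro ⟨h1, h2⟩
    apply n13; ext i; fin_cases i
    · simp [hx1, hx3, h1]
    · simp [hy1, hy3, h2]
  have l12 : 0 < ‖P₂ - P₁‖ := norm_pos_iff.2 (sub_ne_zero.2 n12.symm)
  have l23 : 0 < ‖P₃ - P₂‖ := norm_pos_iff.2 (sub_ne_zero.2 n23.symm)
  have l13 : 0 < ‖P₃ - P₁‖ := norm_pos_iff.2 (sub_ne_zero.2 n13.symm)
  have e12 := aux_norm P₁ P₂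
  have e23 := aux_norm P₂ P₃
  have e13 := aux_norm P₁ P₃
  rw [aux_cos, aux_cos, aux_cos]
  unfold onEllipse at o1 o2 o3
  unfold reflects at r1 r2 r3
  simp only [PiLp.add_apply, PiLp.smul_apply, PiLp.sub_apply, smul_eq_mul] at r1 r2 r3
  simp only [norm_sub_rev P₁ P₂, norm_sub_rev P₁ P₃, norm_sub_rev P₂ P₃] at r1 r2 r3 ⊢
  simp only [hx1, hx2, hx3, hy1, hy2, hy3] at o1 o2 o3 r1 r2 r3 e12 e23 e13 ⊢
  generalize ‖P₂ - P₁‖ = L12 at *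
  generalize ‖P₃ - P₂‖ = L23 at *
  generalize ‖P₃ - P₁‖ = L13 at *
  have o1' : x1 ^ 2 + y1 ^ 2 = 1 := by rw [← o1]; field_simp
  have o2' : x2 ^ 2 + y2 ^ 2 = 1 := by rw [← o2]; field_simp
  have o3' : x3 ^ 2 + y3 ^ 2 = 1 := by rw [← o3]; field_simp
  exact aux_final_s4 a b x1 y1 x2 y2 x3 y3 L12 L13 L23 δ hb hab o1' o2' o3' d12 d13 d23 l12 l13 l23
    e12 e13 e23 r1 r2 r3 hδ hδ2
end
end

section
/- For every 3-periodic billiard orbit P₁P₂P₃ in the ellipse E, the product of the sines of the half-angles is the same and equals sin(θ₁/2)·sin(θ₂/2)·sin(θ₃/2) = (δ − b²)(a² − δ)/(2(a² − b²)²). (Since the angle of the excentral triangle opposite θᵢ is π/2 − θᵢ/2, this is the product of the absolute cosines of the excentral triangle's angles.) -/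
noncomputable section

open EuclideanGeometry Real

lemma aux_pos (u v u' v' : ℝ) (h : u^2+v^2=1) (h' : u'^2+v'^2=1) (hne : ¬ (u = u' ∧ v = v')) :
    0 < 1 - u*u' - v*v' := by
  by_contra hc
  have h1 : (u-u')^2 + (v-v')^2 ≤ 0 := by nlinarith
  have h2 : (u-u')^2 = 0 := le_antisymm (by nlinarith [sq_nonneg (v-v')]) (sq_nonneg _)
  have h3 : (v-v')^2 = 0 := le_antisymm (by nlinarith [sq_nonneg (u-u')]) (sq_nonneg _)
  exact hne ⟨by linarith [pow_eq_zero_iff (two_ne_zero) |>.1 h2], by linarith [pow_eq_zero_iff (two_ne_zero) |>.1 h3]⟩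

lemma aux_refl (a b u v u2 v2 u3 v3 l2 l3 : ℝ) (ha : 0 < a) (hb : 0 < b) (h2 : 0 < l2) (h3 : 0 < l3)
    (n1 : u^2+v^2=1)
    (e2 : l2^2 = a^2*(u2-u)^2 + b^2*(v2-v)^2) (e3 : l3^2 = a^2*(u3-u)^2 + b^2*(v3-v)^2)
    (p2 : 0 < 1 - u*u2 - v*v2) (p3 : 0 < 1 - u*u3 - v*v3)
    (hr : (l2⁻¹ * (a*u2-a*u) + l3⁻¹ * (a*u3-a*u)) * (-(b*v)/b^2) +
      (l2⁻¹ * (b*v2-b*v) + l3⁻¹ * (b*v3-b*v)) * ((a*u)/a^2) = 0) :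
    (1 - u*u2 - v*v2) * l3 = (1 - u*u3 - v*v3) * l2 := by
  have hr' : (-(a^2*(u2-u)*v) + b^2*(v2-v)*u) * l3 = -((-(a^2*(u3-u)*v) + b^2*(v3-v)*u) * l2) := by
    field_simp at hr
    linear_combination hr
  have k : ∀ U V : ℝ, (-(a^2*(U-u)*v) + b^2*(V-v)*u)^2 + a^2*b^2*(1-u*U-v*V)^2
      = (u^2*b^2+v^2*a^2) * (a^2*(U-u)^2 + b^2*(V-v)^2) := by
    intro U V
    have : 1-u*U-v*V = -(u*(U-u)+v*(V-v)) := by linear_combination -n1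
    rw [this]; ring
  have k2 := k u2 v2
  have k3 := k u3 v3
  rw [← e2] at k2
  rw [← e3] at k3
  have hsq : ((1 - u*u2 - v*v2) * l3)^2 = ((1 - u*u3 - v*v3) * l2)^2 := by
    have hab : a^2*b^2 ≠ 0 := by positivity
    apply mul_left_cancel₀ hab
    have hr2 : ((-(a^2*(u2-u)*v) + b^2*(v2-v)*u) * l3)^2 = ((-(a^2*(u3-u)*v) + b^2*(v3-v)*u) * l2)^2 := by
      rw [hr']; ring
    linear_combination l3^2 * k2 - l2^2*k3 - hr2
  exact (pow_left_inj₀ (by positivity) (by positivity) two_ne_zero).1 hsq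

lemma aux_tangent (a b J u v u' v' l : ℝ) (n : u^2+v^2=1) (n' : u'^2+v'^2=1)
    (p : 0 < 1 - u*u' - v*v')
    (e : l^2 = a^2*(u'-u)^2 + b^2*(v'-v)^2) (hJ : 1 - u*u' - v*v' = J*l) :
    (1 - J^2*(a^2-b^2))*u*u' + (1+J^2*(a^2-b^2))*v*v' = 1 - J^2*(a^2+b^2) := by
  -- (u'-u)^2 = (1 - uu' - vv')(1 - uu' + vv')
  have q1 : (u'-u)^2 = (1-u*u'-v*v')*(1-u*u'+v*v') := by
    linear_combination v'^2*n + (1-u^2)*n'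
  have q2 : (v'-v)^2 = (1-u*u'-v*v')*(1+u*u'-v*v') := by
    linear_combination u'^2*n + (1-v^2)*n'
  have : (1-u*u'-v*v')*(1-u*u'-v*v') = (1-u*u'-v*v')*(J^2*(a^2*(1-u*u'+v*v') + b^2*(1+u*u'-v*v'))) := by
    rw [q1, q2] at e
    have : (1-u*u'-v*v')*(1-u*u'-v*v') = J^2*l^2 := by rw [hJ]; ring
    rw [this, e]; ring
  have := mul_left_cancel₀ p.ne' this
  linear_combination -this

lemma aux_line (α β γ u1 v1 u2 v2 u3 v3 : ℝ) (n2 : u2^2+v2^2=1) (n3 : u3^2+v3^2=1)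
    (hne : ¬ (u2 = u3 ∧ v2 = v3))
    (h12 : α*u1*u2+β*v1*v2=γ) (h13 : α*u1*u3+β*v1*v3=γ) :
    (α^2*u1^2+β^2*v1^2)*(u2+u3) = 2*γ*(α*u1) ∧ (α^2*u1^2+β^2*v1^2)*(v2+v3) = 2*γ*(β*v1) ∧
    (α^2*u1^2+β^2*v1^2)*(u2*u3) = γ^2-β^2*v1^2 ∧ (α^2*u1^2+β^2*v1^2)*(v2*v3) = γ^2-α^2*u1^2 := by
  have key : α*u1*(v2+v3) = β*v1*(u2+u3) := by
    have a1 : α*u1*(u2-u3)+β*v1*(v2-v3) = 0 := by linear_combination h12-h13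
    have a2 : (u2+u3)*(u2-u3)+(v2+v3)*(v2-v3) = 0 := by linear_combination n2-n3
    by_cases hu : u2 = u3
    · have hv : v2 - v3 ≠ 0 := fun h => hne ⟨hu, by linarith⟩
      apply mul_right_cancel₀ hv
      linear_combination (α*u1)*a2 - (u2+u3)*a1
    · have hv : u2 - u3 ≠ 0 := fun h => hu (by linarith)
      apply mul_right_cancel₀ hv
      linear_combination (-(β*v1))*a2 + (v2+v3)*a1
  have s1 : (α^2*u1^2+β^2*v1^2)*(u2+u3) = 2*γ*(α*u1) := by
    linear_combination (-(β*v1))*key + α*u1*(h12+h13)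
  have s2 : (α^2*u1^2+β^2*v1^2)*(v2+v3) = 2*γ*(β*v1) := by
    linear_combination ((α*u1))*key + β*v1*(h12+h13)
  refine ⟨s1, s2, ?_, ?_⟩
  · linear_combination u2*s1 - β^2*v1^2*n2 - (γ-α*u1*u2+β*v1*v2)*h12*(-1) 
  · linear_combination v2*s2 - α^2*u1^2*n2 - (γ-β*v1*v2+α*u1*u2)*h12*(-1) 

lemma aux_quad (α β γ u1 v1 u2 v2 u3 v3 : ℝ) (n2 : u2^2+v2^2=1) (n3 : u3^2+v3^2=1)
    (hne : ¬ (u2 = u3 ∧ v2 = v3))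
    (h12 : α*u1*u2+β*v1*v2=γ) (h13 : α*u1*u3+β*v1*v3=γ) (h23 : α*u2*u3+β*v2*v3=γ) :
    (α+β)*γ^2 = α^2*(β+γ)*u1^2+β^2*(α+γ)*v1^2 := by
  obtain ⟨-, -, s3, s4⟩ := aux_line α β γ u1 v1 u2 v2 u3 v3 n2 n3 hne h12 h13
  linear_combination (α^2*u1^2+β^2*v1^2)*h23 - α*s3 - β*s4

lemma aux_signs (α β γ u1 v1 u2 v2 u3 v3 : ℝ)
    (e12 : u1^2 = u2^2) (e13 : u1^2 = u3^2) (f12 : v1^2 = v2^2) (f13 : v1^2 = v3^2)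
    (d12 : ¬ (u1 = u2 ∧ v1 = v2)) (d23 : ¬ (u2 = u3 ∧ v2 = v3)) (d13 : ¬ (u1 = u3 ∧ v1 = v3))
    (h12 : α*u1*u2+β*v1*v2=γ) (h13 : α*u1*u3+β*v1*v3=γ) (h23 : α*u2*u3+β*v2*v3=γ) :
    α*u1^2 = 0 ∧ β*v1^2 = 0 := by
  rcases sq_eq_sq_iff_eq_or_eq_neg.1 e12.symm with h | h <;>
  rcases sq_eq_sq_iff_eq_or_eq_neg.1 e13.symm with h' | h' <;>
  rcases sq_eq_sq_iff_eq_or_eq_neg.1 f12.symm with k | k <;>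
  rcases sq_eq_sq_iff_eq_or_eq_neg.1 f13.symm with k' | k' <;>
  subst h h' k k' <;> clear e12 e13 f12 f13 <;>
  first
  | (exfalso; exact d12 ⟨rfl, rfl⟩)
  | (exfalso; exact d13 ⟨rfl, rfl⟩)
  | (exfalso; exact d23 ⟨rfl, rfl⟩)
  | (clear d12 d13 d23; constructor <;> ring_nf at h12 h13 h23 <;> linarith)

lemma aux_sq0 (x y : ℝ) (h : x^2+y^2=0) : x = 0 ∧ y = 0 := by
  constructor <;> nlinarith

lemma aux_det (u1 v1 u2 v2 u3 v3 : ℝ)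
    (n1 : u1^2+v1^2=1) (n2 : u2^2+v2^2=1) (n3 : u3^2+v3^2=1) :
    ((u2-u1)*(v3-v1)-(u3-u1)*(v2-v1))^2 = 2*(1-u1*u2-v1*v2)*(1-u2*u3-v2*v3)*(1-u1*u3-v1*v3) := by
  have e : (u2-u1)^2+(v2-v1)^2 = 2*(1-u1*u2-v1*v2) := by linear_combination n1+n2
  have f : (u3-u1)^2+(v3-v1)^2 = 2*(1-u1*u3-v1*v3) := by linear_combination n1+n3
  have g : (u2-u1)*(u3-u1)+(v2-v1)*(v3-v1) = 1 + (u2*u3+v2*v3) - (u1*u2+v1*v2) - (u1*u3+v1*v3) := by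
    linear_combination n1
  have d : ((u2-u1)*(v3-v1)-(u3-u1)*(v2-v1))^2 = ((u2-u1)^2+(v2-v1)^2)*((u3-u1)^2+(v3-v1)^2)
     - ((u2-u1)*(u3-u1)+(v2-v1)*(v3-v1))^2 := by ring
  rw [d, e, f, g]
  have s12 : (u1*v2-u2*v1)^2 = 1 - (u1*u2+v1*v2)^2 := by
    linear_combination (u2^2+v2^2)*n1 + n2
  have s13 : (u1*v3-u3*v1)^2 = 1 - (u1*u3+v1*v3)^2 := by
    linear_combination (u3^2+v3^2)*n1 + n3
  have s : (u2*u3+v2*v3) - (u1*u2+v1*v2)*(u1*u3+v1*v3) = (u1*v2-u2*v1)*(u1*v3-u3*v1) := by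
    linear_combination -(u2*u3+v2*v3)*n1
  have gr : ((u2*u3+v2*v3) - (u1*u2+v1*v2)*(u1*u3+v1*v3))^2 = (1 - (u1*u2+v1*v2)^2)*(1 - (u1*u3+v1*v3)^2) := by
    rw [s, ← s12, ← s13]; ring
  linear_combination -gr

lemma aux_cayley (α β γ u1 v1 u2 v2 u3 v3 : ℝ) (hs : α + β = 2) (hαβ : α ≠ β)
    (n1 : u1^2+v1^2=1) (n2 : u2^2+v2^2=1) (n3 : u3^2+v3^2=1)
    (d12 : ¬ (u1 = u2 ∧ v1 = v2)) (d23 : ¬ (u2 = u3 ∧ v2 = v3)) (d13 : ¬ (u1 = u3 ∧ v1 = v3))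
    (h12 : α*u1*u2+β*v1*v2=γ) (h13 : α*u1*u3+β*v1*v3=γ) (h23 : α*u2*u3+β*v2*v3=γ) :
    α*β = -2*γ := by
  have q1 := aux_quad α β γ u1 v1 u2 v2 u3 v3 n2 n3 d23 h12 h13 h23
  have q2 := aux_quad α β γ u2 v2 u1 v1 u3 v3 n1 n3 d13 (by linarith) h23 h13
  have q3 := aux_quad α β γ u3 v3 u1 v1 u2 v2 n1 n2 d12 (by linarith) (by linarith) h12
  by_contra hc
  have hk : (α-β)*(α*β+2*γ) ≠ 0 := mul_ne_zero (sub_ne_zero.2 hαβ) (fun h => hc (by linarith))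
  have hk' : (α-β)*(α*β+2*γ) = α^2*(β+γ) - β^2*(α+γ) := by
    linear_combination -γ*(α-β)*hs
  rw [hk'] at hk
  have e12 : u1^2 = u2^2 := by
    apply mul_left_cancel₀ hk
    linear_combination q2 - q1 - β^2*(α+γ)*(n1-n2)
  have e13 : u1^2 = u3^2 := by
    apply mul_left_cancel₀ hk
    linear_combination q3 - q1 - β^2*(α+γ)*(n1-n3)
  have f12 : v1^2 = v2^2 := by linarith
  have f13 : v1^2 = v3^2 := by linarith
  have hfin : ∀ u v : ℝ, u^2+v^2 = 1 → u ≠ 0 → v ≠ 0 → α*u^2 = 0 → β*v^2=0 → False := by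
    intro u v _ hu hv h1 h2
    have := (mul_eq_zero.1 h1).resolve_right (pow_ne_zero _ hu)
    have := (mul_eq_zero.1 h2).resolve_right (pow_ne_zero _ hv)
    linarith
  have hu : u1 ≠ 0 := by
    rintro rfl
    have g2 : u2 = 0 := by nlinarith
    have g3 : u3 = 0 := by nlinarith
    subst g2 g3
    rcases sq_eq_sq_iff_eq_or_eq_neg.1 f12 with h | h <;>
    rcases sq_eq_sq_iff_eq_or_eq_neg.1 f13 with h' | h'
    · exact d12 ⟨rfl, h⟩
    · exact d12 ⟨rfl, h⟩
    · exact d13 ⟨rfl, h'⟩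
    · exact d23 ⟨rfl, by linarith⟩
  have hv : v1 ≠ 0 := by
    rintro rfl
    have g2 : v2 = 0 := by nlinarith
    have g3 : v3 = 0 := by nlinarith
    subst g2 g3
    rcases sq_eq_sq_iff_eq_or_eq_neg.1 e12 with h | h <;>
    rcases sq_eq_sq_iff_eq_or_eq_neg.1 e13 with h' | h'
    · exact d12 ⟨h, rfl⟩
    · exact d12 ⟨h, rfl⟩
    · exact d13 ⟨h', rfl⟩
    · exact d23 ⟨by linarith, rfl⟩
  obtain ⟨w1, w2⟩ := aux_signs α β γ u1 v1 u2 v2 u3 v3 e12 e13 f12 f13 d12 d23 d13 h12 h13 h23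
  exact hfin u1 v1 n1 hu hv w1 w2

lemma aux_sum (α β γ u1 v1 u2 v2 u3 v3 : ℝ) (hs : α + β = 2) (hc : α*β = -2*γ)
    (n1 : u1^2+v1^2=1) (n2 : u2^2+v2^2=1) (n3 : u3^2+v3^2=1)
    (d23 : ¬ (u2 = u3 ∧ v2 = v3))
    (h12 : α*u1*u2+β*v1*v2=γ) (h13 : α*u1*u3+β*v1*v3=γ) (hD : α^2*u1^2+β^2*v1^2 ≠ 0) :
    u1*u2+v1*v2+(u2*u3+v2*v3)+(u1*u3+v1*v3) = γ - 1 := by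
  obtain ⟨s1, s2, s3, s4⟩ := aux_line α β γ u1 v1 u2 v2 u3 v3 n2 n3 d23 h12 h13
  apply mul_left_cancel₀ hD
  have hD2 : 2*(γ+α*u1^2+β*v1^2) = α^2*u1^2+β^2*v1^2 := by
    have hb : β = 2 - α := by linarith
    subst hb
    linear_combination hc + α*(2-α)*n1
  linear_combination u1*s1+v1*s2+s3+s4 + γ*hD2

lemma aux_half (A B C : Pt) (x y z : ℝ) (hx : 0 < x) (hy : 0 < y) (h1 : dist A B = x) (h2 : dist B C = y) (h3 : dist A C = z) :
    0 ≤ Real.sin (EuclideanGeometry.angle A B C / 2) ∧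
    Real.sin (EuclideanGeometry.angle A B C / 2)^2 = (z-x+y)*(z+x-y)/(4*x*y) := by
  constructor
  · apply Real.sin_nonneg_of_nonneg_of_le_pi
    · have := EuclideanGeometry.angle_nonneg A B C
      linarith
    · have := EuclideanGeometry.angle_le_pi A B C
      have := EuclideanGeometry.angle_nonneg A B C
      linarith
  · have h := EuclideanGeometry.law_cos A B C
    rw [dist_comm C B, h1, h2, h3] at h
    have hc : Real.cos (EuclideanGeometry.angle A B C) = 1 - 2*Real.sin (EuclideanGeometry.angle A B C / 2)^2 := by
      have := Real.cos_two_mul (EuclideanGeometry.angle A B C / 2)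
      rw [mul_div_cancel₀ _ (two_ne_zero)] at this
      have h2 := Real.sin_sq_add_cos_sq (EuclideanGeometry.angle A B C / 2)
      linarith
    rw [hc] at h
    field_simp
    linear_combination -h

lemma aux_prod (A B C : Pt) (x y z : ℝ) (hx : 0 < x) (hy : 0 < y) (hz : 0 < z)
    (h1 : dist A B = x) (h2 : dist B C = y) (h3 : dist A C = z) :
    Real.sin (EuclideanGeometry.angle B A C / 2) * Real.sin (EuclideanGeometry.angle A B C / 2) *
      Real.sin (EuclideanGeometry.angle A C B / 2) = (z-x+y)*(z+x-y)*(x+y-z)/(8*x*y*z) := by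
  obtain ⟨a1, a2⟩ := aux_half B A C x z y hx hz (by rw [dist_comm, h1]) h3 h2
  obtain ⟨b1, b2⟩ := aux_half A B C x y z hx hy h1 h2 h3
  obtain ⟨c1, c2⟩ := aux_half A C B z y x hz hy h3 (by rw [dist_comm, h2]) h1
  have t1 : 0 ≤ z-x+y := by have := dist_triangle_right A B C; linarith
  have t2 : 0 ≤ z+x-y := by have := dist_triangle_left B C A; linarith
  have t3 : 0 ≤ x+y-z := by have := dist_triangle A B C; linarith
  apply (pow_left_inj₀ (by positivity) (by positivity) two_ne_zero).1
  rw [mul_pow, mul_pow, a2, b2, c2]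
  field_simp
  ring

lemma aux_final_s5 (A B S δ : ℝ) (hA : 0 < A) (hB : 0 < B) (hAB : A ≠ B) (hS : 0 < S) (hδ : 0 ≤ δ)
    (hδ2 : δ^2 = A^2 - A*B + B^2)
    (h : S^2*(A-B)^2 + 2*S*(A+B) - 3 = 0) :
    A*B*S^2/(3+S*(A+B)) = (δ-B)*(A-δ)/(2*(A-B)^2) := by
  have hAB' : A - B ≠ 0 := sub_ne_zero.2 hAB
  have hk : S*(A-B)^2 = 2*δ - A - B := by
    have h1 : (S*(A-B)^2 + A + B)^2 = (2*δ)^2 := by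
      linear_combination (A-B)^2*h - 4*hδ2
    have := (pow_left_inj₀ (by positivity) (by positivity) two_ne_zero).1 h1
    linarith
  have hS' : S = (2*δ-A-B)/(A-B)^2 := by field_simp; linarith
  have hpos : 0 < 3+S*(A+B) := by positivity
  rw [div_eq_div_iff hpos.ne' (by positivity)]
  have hq : (A-B)^2 ≠ 0 := by positivity
  apply mul_left_cancel₀ hq
  have e1 : (A-B)^2*(A*B*S^2*(2*(A-B)^2)) = 2*A*B*(2*δ-A-B)^2 := by rw [← hk]; ring
  have e2 : (A-B)^2*((δ-B)*(A-δ)*(3+S*(A+B))) = (δ-B)*(A-δ)*(3*(A-B)^2+(2*δ-A-B)*(A+B)) := by rw [← hk]; ring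
  rw [e1, e2]
  have e3 : (δ-B)*(A-δ) = δ*(A+B)-A^2-B^2 := by linear_combination -hδ2
  rw [e3]
  linear_combination (8*A*B - 2*(A+B)^2)*hδ2

lemma aux_main (a b : ℝ) (hb : 0 < b) (hab : b < a) (u1 v1 u2 v2 u3 v3 x y z J δ : ℝ)
    (hx : 0 < x) (hy : 0 < y) (hz : 0 < z) (hδ : 0 ≤ δ) (hδ2 : δ^2 = a^4-a^2*b^2+b^4)
    (n1 : u1^2+v1^2=1) (n2 : u2^2+v2^2=1) (n3 : u3^2+v3^2=1)
    (d12 : ¬ (u1 = u2 ∧ v1 = v2)) (d23 : ¬ (u2 = u3 ∧ v2 = v3)) (d13 : ¬ (u1 = u3 ∧ v1 = v3))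
    (ex : x^2 = a^2*(u2-u1)^2+b^2*(v2-v1)^2)
    (ey : y^2 = a^2*(u3-u2)^2+b^2*(v3-v2)^2)
    (ez : z^2 = a^2*(u3-u1)^2+b^2*(v3-v1)^2)
    (jx : 1-u1*u2-v1*v2 = J*x) (jy : 1-u2*u3-v2*v3 = J*y) (jz : 1-u1*u3-v1*v3 = J*z) :
    (z-x+y)*(z+x-y)*(x+y-z)/(8*x*y*z) = (δ - b ^ 2) * (a ^ 2 - δ) / (2 * (a ^ 2 - b ^ 2) ^ 2) := by
  have ha : 0 < a := hb.trans hab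
  have p12 := aux_pos u1 v1 u2 v2 n1 n2 d12
  have p23 := aux_pos u2 v2 u3 v3 n2 n3 d23
  have p13 := aux_pos u1 v1 u3 v3 n1 n3 d13
  have hJ : 0 < J := by rw [jx] at p12; exact pos_of_mul_pos_left p12 hx.le
  have hsq : b^2 < a^2 := by nlinarith
  have hm : 0 < J^2*(a^2-b^2) := mul_pos (by positivity) (by linarith)
  have t12 := aux_tangent a b J u1 v1 u2 v2 x n1 n2 p12 ex jx
  have t23 := aux_tangent a b J u2 v2 u3 v3 y n2 n3 p23 ey jy
  have t13 := aux_tangent a b J u1 v1 u3 v3 z n1 n3 p13 ez jz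
  have hc := aux_cayley _ _ _ u1 v1 u2 v2 u3 v3 (by ring) (by intro h; linarith) n1 n2 n3 d12 d23 d13 t12 t13 t23
  have hD : (1 - J^2*(a^2-b^2))^2*u1^2+(1+J^2*(a^2-b^2))^2*v1^2 ≠ 0 := by
    intro h0
    have hβ : 0 < 1+J^2*(a^2-b^2) := by linarith
    obtain ⟨z1', z2'⟩ := aux_sq0 ((1 - J^2*(a^2-b^2))*u1) ((1 + J^2*(a^2-b^2))*v1) (by rw [mul_pow, mul_pow]; exact h0)
    have hγ : 1 - J^2*(a^2+b^2) = 0 := by linear_combination u2*z1'+v2*z2'-t12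
    have hα : 0 < 1 - J^2*(a^2-b^2) := by
      have h2 : 1 - J^2*(a^2-b^2) = 2*(J^2*b^2) := by linear_combination hγ
      rw [h2]; positivity
    have := (mul_eq_zero.1 z1').resolve_left hα.ne'
    have := (mul_eq_zero.1 z2').resolve_left hβ.ne'
    have hu0 : u1 = 0 := by assumption
    have hv0 : v1 = 0 := by assumption
    rw [hu0, hv0] at n1
    norm_num at n1
  have hsum := aux_sum _ _ _ u1 v1 u2 v2 u3 v3 (by ring) hc n1 n2 n3 d23 t12 t13 hD
  rw [← aux_final_s5 (a^2) (b^2) (J^2) δ (by positivity) (by positivity) hsq.ne' (by positivity) hδ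
    (by rw [hδ2]; ring) (by linear_combination -hc)]
  have hper : J*(x+y+z) = 3 + J^2*(a^2+b^2) := by linear_combination -hsum - jx - jy - jz
  rw [← hper]
  have heron : (x+y+z)*((z-x+y)*(z+x-y)*(x+y-z)) = 4*a^2*b^2*((u2-u1)*(v3-v1)-(u3-u1)*(v2-v1))^2 := by
    have : (x+y+z)*((z-x+y)*(z+x-y)*(x+y-z)) = 4*x^2*z^2 - (x^2+z^2-y^2)^2 := by ring
    rw [this, ex, ey, ez]; ring
  have hdet : ((u2-u1)*(v3-v1)-(u3-u1)*(v2-v1))^2 = 2*(J*x)*(J*y)*(J*z) := by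
    rw [← jx, ← jy, ← jz]
    exact aux_det u1 v1 u2 v2 u3 v3 n1 n2 n3
  rw [hdet] at heron
  rw [div_eq_div_iff (by positivity) (by positivity)]
  linear_combination J*heron

theorem product_sin_half_angles (a b : ℝ) (hb : 0 < b) (hab : b < a)
    (P₁ P₂ P₃ : Pt) (h : IsOrbit a b P₁ P₂ P₃) :
    let δ := Real.sqrt (a ^ 4 - a ^ 2 * b ^ 2 + b ^ 4)
    Real.sin (EuclideanGeometry.angle P₂ P₁ P₃ / 2) *
      Real.sin (EuclideanGeometry.angle P₁ P₂ P₃ / 2) *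
      Real.sin (EuclideanGeometry.angle P₁ P₃ P₂ / 2) =
      (δ - b ^ 2) * (a ^ 2 - δ) / (2 * (a ^ 2 - b ^ 2) ^ 2) := by
  intro δ
  have ha : 0 < a := hb.trans hab
  obtain ⟨d12, d23, d13, o1, o2, o3, r1, r2, r3⟩ := h
  have hδ2 : δ^2 = a ^ 4 - a ^ 2 * b ^ 2 + b ^ 4 :=
    Real.sq_sqrt (by nlinarith [sq_nonneg (a^2-b^2), mul_pos (pow_pos ha 2) (pow_pos hb 2)])
  have hu : ∀ P : Pt, P 0 = a * (P 0 / a) := fun P => by field_simp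
  have hv : ∀ P : Pt, P 1 = b * (P 1 / b) := fun P => by field_simp
  have hn : ∀ P : Pt, onEllipse a b P → (P 0 / a)^2 + (P 1 / b)^2 = 1 := by
    intro P hP
    unfold onEllipse at hP
    rw [div_pow, div_pow, hP]
  have hd : ∀ P Q : Pt, P ≠ Q → ¬ (P 0 / a = Q 0 / a ∧ P 1 / b = Q 1 / b) := by
    rintro P Q hne ⟨h0, h1⟩
    apply hne
    ext i
    fin_cases i
    · exact (div_left_inj' ha.ne').1 h0
    · exact (div_left_inj' hb.ne').1 h1
  have hdist : ∀ P Q : Pt, dist P Q ^ 2 = a^2*(Q 0 / a - P 0 / a)^2 + b^2*(Q 1 / b - P 1 / b)^2 := by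
    intro P Q
    rw [EuclideanSpace.dist_eq, Real.sq_sqrt (by positivity)]
    simp only [Fin.sum_univ_two, Real.dist_eq, sq_abs]
    field_simp
    ring
  have hrefl : ∀ P Q R : Pt, P ≠ Q → P ≠ R → onEllipse a b P → onEllipse a b Q → onEllipse a b R →
      reflects a b P Q R →
      (1 - P 0 / a * (Q 0 / a) - P 1 / b * (Q 1 / b)) * dist P R =
      (1 - P 0 / a * (R 0 / a) - P 1 / b * (R 1 / b)) * dist P Q := by
    intro P Q R hPQ hPR oP oQ oR hr
    apply aux_refl a b _ _ _ _ _ _ _ _ ha hb (dist_pos.2 hPQ) (dist_pos.2 hPR) (hn P oP)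
      (hdist P Q) (hdist P R) (aux_pos _ _ _ _ (hn P oP) (hn Q oQ) (hd _ _ hPQ))
      (aux_pos _ _ _ _ (hn P oP) (hn R oR) (hd _ _ hPR))
    rw [← hu, ← hu, ← hu, ← hv, ← hv, ← hv]
    unfold reflects at hr
    rw [← dist_eq_norm, ← dist_eq_norm, dist_comm Q, dist_comm R] at hr
    simpa using hr
  have k1 := hrefl P₁ P₂ P₃ d12 d13 o1 o2 o3 r1
  have k2 := hrefl P₂ P₃ P₁ d23 d12.symm o2 o3 o1 r2
  have hx := dist_pos.2 d12
  have hy := dist_pos.2 d23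
  have hz := dist_pos.2 d13
  rw [aux_prod P₁ P₂ P₃ _ _ _ hx hy hz rfl rfl rfl]
  rw [dist_comm P₂ P₁] at k2
  refine aux_main a b hb hab (P₁ 0 / a) (P₁ 1 / b) (P₂ 0 / a) (P₂ 1 / b) (P₃ 0 / a) (P₃ 1 / b) _ _ _
    ((1 - P₁ 0 / a * (P₂ 0 / a) - P₁ 1 / b * (P₂ 1 / b)) / dist P₁ P₂) δ hx hy hz (Real.sqrt_nonneg _) hδ2
    (hn _ o1) (hn _ o2) (hn _ o3) (hd _ _ d12) (hd _ _ d23) (hd _ _ d13) (hdist _ _) (hdist _ _) (hdist _ _) ?_ ?_ ?_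
  · rw [div_mul_cancel₀ _ hx.ne']
  · apply mul_right_cancel₀ hx.ne'
    have e := div_mul_cancel₀ (1 - P₁ 0 / a * (P₂ 0 / a) - P₁ 1 / b * (P₂ 1 / b)) hx.ne'
    linear_combination k2 - dist P₂ P₃ * e
  · apply mul_right_cancel₀ hx.ne'
    have e := div_mul_cancel₀ (1 - P₁ 0 / a * (P₂ 0 / a) - P₁ 1 / b * (P₂ 1 / b)) hx.ne'
    linear_combination -k1 - dist P₁ P₃ * e
end
end

section
/- For every 3-periodic billiard orbit P₁P₂P₃ in the ellipse E, the three extouch points Q₁, Q₂, Q₃ lie on the confocal caustic, i.e., each Qᵢ = (qₓ, q_y) satisfies qₓ²/a_c² + q_y²/b_c² = 1, where a_c = a(δ − b²)/c² and b_c = b(a² − δ)/c². -/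
noncomputable section

open EuclideanGeometry Real

lemma ec_dpos (x y z w : ℝ) (h1 : x ^ 2 + y ^ 2 = 1) (h2 : z ^ 2 + w ^ 2 = 1)
    (hne : x ≠ z ∨ y ≠ w) : 0 < 1 - (x * z + y * w) := by
  have : 1 - (x * z + y * w) = ((x - z) ^ 2 + (y - w) ^ 2) / 2 := by linarith
  rw [this]
  rcases hne with h | h
  · have := pow_pos (abs_pos.2 (sub_ne_zero.2 h)) 2
    rw [sq_abs] at this
    positivity
  · have := pow_pos (abs_pos.2 (sub_ne_zero.2 h)) 2
    rw [sq_abs] at this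
    positivity

/-- Joachimsthal invariant is preserved by reflection. -/
lemma ec_refl (a b x y x2 y2 x3 y3 s r : ℝ) (ha : 0 < a) (hb : 0 < b) (hs : 0 < s) (hr : 0 < r)
    (h1 : x ^ 2 + y ^ 2 = 1)
    (d2 : 0 < 1 - (x * x2 + y * y2)) (d3 : 0 < 1 - (x * x3 + y * y3))
    (hs2 : s ^ 2 = a ^ 2 * (x2 - x) ^ 2 + b ^ 2 * (y2 - y) ^ 2)
    (hr2 : r ^ 2 = a ^ 2 * (x3 - x) ^ 2 + b ^ 2 * (y3 - y) ^ 2)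
    (href : (s⁻¹ * (a * x2 - a * x) + r⁻¹ * (a * x3 - a * x)) * (-(b * y) / b ^ 2) +
      (s⁻¹ * (b * y2 - b * y) + r⁻¹ * (b * y3 - b * y)) * ((a * x) / a ^ 2) = 0) :
    (1 - (x * x2 + y * y2)) * r = (1 - (x * x3 + y * y3)) * s := by
  obtain ⟨u, hu⟩ : ∃ u, u = a * (x2 - x) / s := ⟨_, rfl⟩
  obtain ⟨u', hu'⟩ : ∃ u, u = b * (y2 - y) / s := ⟨_, rfl⟩
  obtain ⟨v, hv⟩ : ∃ u, u = a * (x3 - x) / r := ⟨_, rfl⟩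
  obtain ⟨v', hv'⟩ : ∃ u, u = b * (y3 - y) / r := ⟨_, rfl⟩
  have hu1 : u ^ 2 + u' ^ 2 = 1 := by
    rw [hu, hu']; field_simp; linarith
  have hv1 : v ^ 2 + v' ^ 2 = 1 := by
    rw [hv, hv']; field_simp; linarith
  have hcr : (u + v) * (y / b) = (u' + v') * (x / a) := by
    rw [hu, hu', hv, hv']
    have e : ∀ t : ℝ, (b * t) / b ^ 2 = t / b := fun t => by field_simp
    have e' : ∀ t : ℝ, (a * t) / a ^ 2 = t / a := fun t => by field_simp
    rw [neg_div, e, e'] at href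
    linear_combination -href
  have hun : u * (x / a) + u' * (y / b) = -(1 - (x * x2 + y * y2)) / s := by
    rw [hu, hu']; field_simp; linear_combination -h1
  have hvn : v * (x / a) + v' * (y / b) = -(1 - (x * x3 + y * y3)) / r := by
    rw [hv, hv']; field_simp; linear_combination -h1
  have p2 : 0 < (1 - (x * x2 + y * y2)) / s := div_pos d2 hs
  have p3 : 0 < (1 - (x * x3 + y * y3)) / r := div_pos d3 hr
  generalize x / a = m at *
  generalize y / b = n at *
  have key : ((u * m + u' * n) - (v * m + v' * n)) * ((u * m + u' * n) + (v * m + v' * n)) = 0 := by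
    linear_combination (m ^ 2 + n ^ 2) * (hu1 - hv1) - ((u - v) * n - (u' - v') * m) * hcr
  rw [hun, hvn] at key
  rcases mul_eq_zero.1 key with h | h
  · have : (1 - (x * x2 + y * y2)) / s = (1 - (x * x3 + y * y3)) / r := by
      rw [neg_div, neg_div] at h; linarith
    rwa [div_eq_div_iff hs.ne' hr.ne'] at this
  · rw [neg_div, neg_div] at h; linarith

lemma ec_chord (a b K x y z w : ℝ) (h1 : x ^ 2 + y ^ 2 = 1) (h2 : z ^ 2 + w ^ 2 = 1)
    (d : 0 < 1 - (x * z + y * w))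
    (h : K * (1 - (x * z + y * w)) ^ 2 = a ^ 2 * (x - z) ^ 2 + b ^ 2 * (y - w) ^ 2) :
    (K - a ^ 2 + b ^ 2) * (x * z) + (K + a ^ 2 - b ^ 2) * (y * w) = K - a ^ 2 - b ^ 2 := by
  have e1 : (x - z) ^ 2 = (1 - (x * z + y * w)) * (1 - x * z + y * w) := by
    have : (y * w) ^ 2 = (1 - x ^ 2) * (1 - z ^ 2) := by
      rw [sub_eq_of_eq_add' h1.symm, sub_eq_of_eq_add' h2.symm]; ring
    linear_combination this
  have e2 : (y - w) ^ 2 = (1 - (x * z + y * w)) * (1 + x * z - y * w) := by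
    have : (x * z) ^ 2 = (1 - y ^ 2) * (1 - w ^ 2) := by
      rw [sub_eq_of_eq_add h1.symm, sub_eq_of_eq_add h2.symm]; ring
    linear_combination this
  rw [e1, e2] at h
  apply mul_left_cancel₀ d.ne'
  linear_combination -h

set_option maxHeartbeats 1000000 in
lemma ec_core (a b x1 y1 x2 y2 x3 y3 s1 s2 s3 : ℝ) (hb : 0 < b) (hab : b < a)
    (h1 : x1 ^ 2 + y1 ^ 2 = 1) (h2 : x2 ^ 2 + y2 ^ 2 = 1) (h3 : x3 ^ 2 + y3 ^ 2 = 1)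
    (d12 : 0 < 1 - (x1 * x2 + y1 * y2)) (d13 : 0 < 1 - (x1 * x3 + y1 * y3))
    (d23 : 0 < 1 - (x2 * x3 + y2 * y3))
    (p1 : 0 < s1) (p2 : 0 < s2) (p3 : 0 < s3)
    (q1 : s1 ^ 2 = a ^ 2 * (x2 - x3) ^ 2 + b ^ 2 * (y2 - y3) ^ 2)
    (q2 : s2 ^ 2 = a ^ 2 * (x1 - x3) ^ 2 + b ^ 2 * (y1 - y3) ^ 2)
    (q3 : s3 ^ 2 = a ^ 2 * (x1 - x2) ^ 2 + b ^ 2 * (y1 - y2) ^ 2)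
    (r1 : (1 - (x1 * x2 + y1 * y2)) * s2 = (1 - (x1 * x3 + y1 * y3)) * s3)
    (r2 : (1 - (x2 * x3 + y2 * y3)) * s3 = (1 - (x1 * x2 + y1 * y2)) * s1)
    (δ α β : ℝ) (hδ0 : 0 ≤ δ) (hδ : δ ^ 2 = a ^ 4 - a ^ 2 * b ^ 2 + b ^ 4)
    (hα : α = (δ - b ^ 2) / (a ^ 2 - b ^ 2)) (hβ : β = (a ^ 2 - δ) / (a ^ 2 - b ^ 2)) :
    x2 + (((s1 + s2 + s3) / 2 - s3) / s1) * (x3 - x2) = -α * x1 ∧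
    y2 + (((s1 + s2 + s3) / 2 - s3) / s1) * (y3 - y2) = -β * y1 := by
  have ha : 0 < a := hb.trans hab
  have hc : 0 < a ^ 2 - b ^ 2 := sub_pos.2 (pow_lt_pow_left₀ hab hb.le two_ne_zero)
  obtain ⟨k, hk⟩ : ∃ k, k = s3 / (1 - (x1 * x2 + y1 * y2)) := ⟨_, rfl⟩
  have hk0 : 0 < k := hk ▸ div_pos p3 d12
  have e3 : s3 = k * (1 - (x1 * x2 + y1 * y2)) := by rw [hk]; field_simp
  have e2 : s2 = k * (1 - (x1 * x3 + y1 * y3)) := by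
    rw [hk, div_mul_eq_mul_div, eq_div_iff d12.ne']; linarith
  have e1 : s1 = k * (1 - (x2 * x3 + y2 * y3)) := by
    rw [hk, div_mul_eq_mul_div, eq_div_iff d12.ne']; linarith
  have c12 := ec_chord a b (k ^ 2) x1 y1 x2 y2 h1 h2 d12 (by rw [← q3, e3]; ring)
  have c13 := ec_chord a b (k ^ 2) x1 y1 x3 y3 h1 h3 d13 (by rw [← q2, e2]; ring)
  have c23 := ec_chord a b (k ^ 2) x2 y2 x3 y3 h2 h3 d23 (by rw [← q1, e1]; ring)
  have hτ : ((s1 + s2 + s3) / 2 - s3) / s1 * (2 * (1 - (x2 * x3 + y2 * y3))) =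
      (1 - (x2 * x3 + y2 * y3)) + (1 - (x1 * x3 + y1 * y3)) - (1 - (x1 * x2 + y1 * y2)) := by
    rw [e1, e2, e3]
    field_simp
    ring
  generalize ((s1 + s2 + s3) / 2 - s3) / s1 = τ at *
  obtain ⟨K, hK⟩ : ∃ K, K = k ^ 2 := ⟨_, rfl⟩
  have hK0 : 0 < K := by rw [hK]; positivity
  rw [← hK] at c12 c13 c23
  clear hK e1 e2 e3 hk r1 r2 q1 q2 q3
  obtain ⟨U, hU⟩ : ∃ U, U = K - a ^ 2 + b ^ 2 := ⟨_, rfl⟩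
  obtain ⟨V, hV⟩ : ∃ U, U = K + a ^ 2 - b ^ 2 := ⟨_, rfl⟩
  obtain ⟨W, hW⟩ : ∃ U, U = K - a ^ 2 - b ^ 2 := ⟨_, rfl⟩
  rw [← hU, ← hV, ← hW] at c12 c13 c23
  obtain ⟨m, hm⟩ : ∃ m, m = U * x1 := ⟨_, rfl⟩
  obtain ⟨n, hn⟩ : ∃ n, n = V * y1 := ⟨_, rfl⟩
  have l2 : m * x2 + n * y2 = W := by rw [hm, hn]; linarith
  have l3 : m * x3 + n * y3 = W := by rw [hm, hn]; linarith
  have hN : 0 < m ^ 2 + n ^ 2 := by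
    by_contra hcon
    have hm0 : m = 0 := pow_eq_zero_iff two_ne_zero |>.1 (by linarith [sq_nonneg m, sq_nonneg n])
    have hn0 : n = 0 := pow_eq_zero_iff two_ne_zero |>.1 (by linarith [sq_nonneg m, sq_nonneg n])
    have hW0 : W = 0 := by rw [← l2, hm0, hn0]; ring
    have hUp : 0 < U := by linarith [pow_pos hb 2]
    have hVp : 0 < V := by linarith [pow_pos hb 2]
    have hx : x1 = 0 := by
      rcases mul_eq_zero.1 (hm.symm.trans hm0) with h | h
      · exact absurd h hUp.ne'
      · exact h
    have hy : y1 = 0 := by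
      rcases mul_eq_zero.1 (hn.symm.trans hn0) with h | h
      · exact absurd h hVp.ne'
      · exact h
    rw [hx, hy] at h1; norm_num at h1
  obtain ⟨c, hcd⟩ : ∃ c, c = m * y2 - n * x2 := ⟨_, rfl⟩
  obtain ⟨c', hcd'⟩ : ∃ c, c = m * y3 - n * x3 := ⟨_, rfl⟩
  have hc2 : c ^ 2 = m ^ 2 + n ^ 2 - W ^ 2 := by
    rw [hcd, ← l2]; linear_combination (m ^ 2 + n ^ 2) * h2
  have hc3 : c' ^ 2 = m ^ 2 + n ^ 2 - W ^ 2 := by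
    rw [hcd', ← l3]; linear_combination (m ^ 2 + n ^ 2) * h3
  have X2 : (m ^ 2 + n ^ 2) * x2 = W * m - c * n := by rw [hcd, ← l2]; ring
  have Y2 : (m ^ 2 + n ^ 2) * y2 = W * n + c * m := by rw [hcd, ← l2]; ring
  have X3 : (m ^ 2 + n ^ 2) * x3 = W * m - c' * n := by rw [hcd', ← l3]; ring
  have Y3 : (m ^ 2 + n ^ 2) * y3 = W * n + c' * m := by rw [hcd', ← l3]; ring
  have hcc : c' = -c := by
    have : (c' - c) * (c' + c) = 0 := by linear_combination hc3 - hc2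
    rcases mul_eq_zero.1 this with h | h
    · exfalso
      have h' : c' = c := by linarith
      rw [h'] at X3 Y3
      have hx : x3 = x2 := mul_left_cancel₀ hN.ne' (X3.trans X2.symm)
      have hy : y3 = y2 := mul_left_cancel₀ hN.ne' (Y3.trans Y2.symm)
      rw [hx, hy] at d23
      linarith
    · linarith
  have XX : (m ^ 2 + n ^ 2) * (x2 * x3) = W ^ 2 - n ^ 2 := by
    apply mul_left_cancel₀ hN.ne'
    have : (m ^ 2 + n ^ 2) * ((m ^ 2 + n ^ 2) * (x2 * x3)) =
      (W * m - c * n) * (W * m - c' * n) := by rw [← X2, ← X3]; ring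
    rw [this, hcc]; linear_combination -n ^ 2 * hc2
  have YY : (m ^ 2 + n ^ 2) * (y2 * y3) = W ^ 2 - m ^ 2 := by
    apply mul_left_cancel₀ hN.ne'
    have : (m ^ 2 + n ^ 2) * ((m ^ 2 + n ^ 2) * (y2 * y3)) =
      (W * n + c * m) * (W * n + c' * m) := by rw [← Y2, ← Y3]; ring
    rw [this, hcc]; linear_combination -m ^ 2 * hc2
  have main : U * (W ^ 2 - n ^ 2) + V * (W ^ 2 - m ^ 2) = W * (m ^ 2 + n ^ 2) := by
    rw [← XX, ← YY, ← c23]; ring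
  have fac : (U * V + U * W + V * W) * ((U - W) * x1 ^ 2 + (V - W) * y1 ^ 2) = 0 := by
    rw [hm, hn] at main
    linear_combination -main - (U + V) * W ^ 2 * h1
  have pos : 0 < (U - W) * x1 ^ 2 + (V - W) * y1 ^ 2 := by
    have e : (U - W) * x1 ^ 2 + (V - W) * y1 ^ 2 = 2 * b ^ 2 + 2 * (a ^ 2 - b ^ 2) * y1 ^ 2 := by
      rw [hU, hV, hW]; linear_combination 2 * b ^ 2 * h1
    rw [e]; positivity
  have hUVW : U * V + U * W + V * W = 0 := by
    rcases mul_eq_zero.1 fac with h | h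
    · exact h
    · exact absurd h pos.ne'
  have hKδ : 3 * K = a ^ 2 + b ^ 2 + 2 * δ := by
    have : (3 * K - (a ^ 2 + b ^ 2) - 2 * δ) * (3 * K - (a ^ 2 + b ^ 2) + 2 * δ) = 0 := by
      rw [hU, hV, hW] at hUVW
      linear_combination 3 * hUVW - 4 * hδ
    rcases mul_eq_zero.1 this with h | h
    · linarith
    · exfalso
      have hs : a ^ 2 + b ^ 2 < 2 * δ := by
        exact lt_of_pow_lt_pow_left₀ 2 (by positivity) (by linarith [mul_pos hc hc])
      linarith
  have hVα : V = 2 * α * K := by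
    rw [hα, hV]; field_simp
    have hKK : K = (a ^ 2 + b ^ 2 + 2 * δ) / 3 := by linarith
    rw [hKK]; linear_combination (-4/3) * hδ
  have hαβ : α + β = 1 := by rw [hα, hβ]; field_simp; ring
  have hUβ : U = 2 * β * K := by
    have : U + V = 2 * K := by rw [hU, hV]; ring
    have hb' : β = 1 - α := by linarith
    rw [hb']; linarith
  have hWαβ : W = -2 * α * β * K := by
    have hs : U + V = 2 * K := by rw [hU, hV]; ring
    apply mul_left_cancel₀ (by positivity : 2 * K ≠ 0)
    have : 2 * K * W = - (U * V) := by rw [← hs]; linarith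
    rw [this, hUβ, hVα]; ring
  -- the error vector
  obtain ⟨e, he⟩ : ∃ e, e = x2 + τ * (x3 - x2) + α * x1 := ⟨_, rfl⟩
  obtain ⟨f, hf⟩ : ∃ e, e = y2 + τ * (y3 - y2) + β * y1 := ⟨_, rfl⟩
  have en : m * e + n * f = 0 := by
    have : m * e + n * f = (1 - τ) * W + τ * W + (α * U * x1 ^ 2 + β * V * y1 ^ 2) := by
      rw [he, hf]
      have t1 : α * U * x1 ^ 2 = m * (α * x1) := by rw [hm]; ring
      have t2 : β * V * y1 ^ 2 = n * (β * y1) := by rw [hn]; ring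
      rw [t1, t2]
      linear_combination (1 - τ) * l2 + τ * l3
    rw [this, hWαβ, hUβ, hVα]
    linear_combination 2 * α * β * K * h1
  have perp : β * x1 * (x3 - x2) + α * y1 * (y3 - y2) = 0 := by
    apply mul_left_cancel₀ (by positivity : 2 * K ≠ 0)
    rw [hm, hn, hUβ, hVα] at l2 l3
    linear_combination l3 - l2
  have eD : e * (x3 - x2) + f * (y3 - y2) = 0 := by
    have ha' : α = 1 - β := by linarith
    have hb' : β = 1 - α := by linarith
    have hp : α * x1 * (x3 - x2) + β * y1 * (y3 - y2) = x1 * (x3 - x2) + y1 * (y3 - y2) := by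
      linear_combination (x1 * (x3 - x2) + y1 * (y3 - y2)) * hαβ - perp
    rw [he, hf]
    linear_combination hp + hτ + (τ - 1) * h2 + τ * h3
  have D : m * (x3 - x2) + n * (y3 - y2) = 0 := by linarith
  have cr : e * (y3 - y2) - f * (x3 - x2) = 0 := by
    apply mul_left_cancel₀ hN.ne'
    linear_combination (m * (y3 - y2) - n * (x3 - x2)) * en - (m * f - n * e) * D
  have hD : 0 < (x3 - x2) ^ 2 + (y3 - y2) ^ 2 := by linarith
  have e0 : e = 0 := by
    apply mul_left_cancel₀ hD.ne'
    linear_combination (x3 - x2) * eD + (y3 - y2) * cr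
  have f0 : f = 0 := by
    apply mul_left_cancel₀ hD.ne'
    linear_combination (y3 - y2) * eD - (x3 - x2) * cr
  constructor <;> linarith

lemma ec_norm (P Q : Pt) : ‖P - Q‖ ^ 2 = (P 0 - Q 0) ^ 2 + (P 1 - Q 1) ^ 2 := by
  rw [EuclideanSpace.norm_sq_eq]
  simp [Fin.sum_univ_two]

set_option maxHeartbeats 1000000 in
lemma ec_one (a b : ℝ) (hb : 0 < b) (hab : b < a)
    (P₁ P₂ P₃ : Pt) (h : IsOrbit a b P₁ P₂ P₃) (s₁ s₂ s₃ L δ : ℝ)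
    (hs1 : s₁ = ‖P₃ - P₂‖) (hs2 : s₂ = ‖P₁ - P₃‖) (hs3 : s₃ = ‖P₂ - P₁‖)
    (hL : L = s₁ + s₂ + s₃) (hd : δ = Real.sqrt (a ^ 4 - a ^ 2 * b ^ 2 + b ^ 4)) :
    ((P₂ + ((L / 2 - s₃) / s₁) • (P₃ - P₂) : Pt) 0) ^ 2 /
        (a * (δ - b ^ 2) / (a ^ 2 - b ^ 2)) ^ 2 +
      ((P₂ + ((L / 2 - s₃) / s₁) • (P₃ - P₂) : Pt) 1) ^ 2 /
        (b * (a ^ 2 - δ) / (a ^ 2 - b ^ 2)) ^ 2 = 1 := by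
  obtain ⟨n12, n23, n13, o1, o2, o3, r1, r2, r3⟩ := h
  have ha : 0 < a := hb.trans hab
  have hc : 0 < a ^ 2 - b ^ 2 := sub_pos.2 (pow_lt_pow_left₀ hab hb.le two_ne_zero)
  have p1 : 0 < s₁ := by rw [hs1]; exact norm_pos_iff.2 (sub_ne_zero.2 n23.symm)
  have p2 : 0 < s₂ := by rw [hs2]; exact norm_pos_iff.2 (sub_ne_zero.2 n13)
  have p3 : 0 < s₃ := by rw [hs3]; exact norm_pos_iff.2 (sub_ne_zero.2 n12.symm)
  have q1 : s₁ ^ 2 = _ := hs1 ▸ ec_norm P₃ P₂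
  have q2 : s₂ ^ 2 = _ := hs2 ▸ ec_norm P₁ P₃
  have q3 : s₃ ^ 2 = _ := hs3 ▸ ec_norm P₂ P₁
  unfold reflects at r1 r2 r3
  rw [← hs3, norm_sub_rev P₃ P₁, ← hs2] at r1
  rw [← hs1, norm_sub_rev P₁ P₂, ← hs3] at r2
  rw [← hs2, norm_sub_rev P₂ P₃, ← hs1] at r3
  have hne : ∀ P Q : Pt, P ≠ Q → P 0 / a ≠ Q 0 / a ∨ P 1 / b ≠ Q 1 / b := by
    intro P Q hPQ
    by_contra! hcon
    apply hPQ
    ext i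
    fin_cases i
    · exact (div_left_inj' ha.ne').1 hcon.1
    · exact (div_left_inj' hb.ne').1 hcon.2
  have m12 := hne _ _ n12
  have m23 := hne _ _ n23
  have m13 := hne _ _ n13
  unfold onEllipse at o1 o2 o3
  simp only [← div_pow] at o1 o2 o3
  simp only [PiLp.add_apply, PiLp.smul_apply, PiLp.sub_apply, smul_eq_mul] at r1 r2 r3 ⊢
  have ea : ∀ P : Pt, P 0 = a * (P 0 / a) := fun P => by field_simp
  have eb : ∀ P : Pt, P 1 = b * (P 1 / b) := fun P => by field_simp
  obtain ⟨x1, hx1⟩ : ∃ x, x = P₁ 0 / a := ⟨_, rfl⟩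
  obtain ⟨x2, hx2⟩ : ∃ x, x = P₂ 0 / a := ⟨_, rfl⟩
  obtain ⟨x3, hx3⟩ : ∃ x, x = P₃ 0 / a := ⟨_, rfl⟩
  obtain ⟨y1, hy1⟩ : ∃ x, x = P₁ 1 / b := ⟨_, rfl⟩
  obtain ⟨y2, hy2⟩ : ∃ x, x = P₂ 1 / b := ⟨_, rfl⟩
  obtain ⟨y3, hy3⟩ : ∃ x, x = P₃ 1 / b := ⟨_, rfl⟩
  have ex1 := ea P₁
  have ex2 := ea P₂
  have ex3 := ea P₃
  have ey1 := eb P₁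
  have ey2 := eb P₂
  have ey3 := eb P₃
  rw [← hx1] at o1 m12 m13 ex1
  rw [← hx2] at o2 m12 m23 ex2
  rw [← hx3] at o3 m13 m23 ex3
  rw [← hy1] at o1 m12 m13 ey1
  rw [← hy2] at o2 m12 m23 ey2
  rw [← hy3] at o3 m13 m23 ey3
  rw [ex1, ex2, ex3, ey1, ey2, ey3] at r1 r2 r3
  rw [ex2, ex3, ey2, ey3] at q1 ⊢
  rw [ex1, ex3, ey1, ey3] at q2
  rw [ex1, ex2, ey1, ey2] at q3
  have d12 := ec_dpos x1 y1 x2 y2 o1 o2 m12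
  have d13 := ec_dpos x1 y1 x3 y3 o1 o3 m13
  have d23 := ec_dpos x2 y2 x3 y3 o2 o3 m23
  have R1 := ec_refl a b x1 y1 x2 y2 x3 y3 s₃ s₂ ha hb p3 p2 o1 d12 d13
    (by rw [q3]; ring) (by rw [q2]; ring) r1
  have R2 := ec_refl a b x2 y2 x3 y3 x1 y1 s₁ s₃ ha hb p1 p3 o2 d23 (by linarith)
    (by rw [q1]; ring) (by rw [q3]; ring) r2
  have hrad : 0 ≤ a ^ 4 - a ^ 2 * b ^ 2 + b ^ 4 := by
    linarith [sq_nonneg (a ^ 2 - b ^ 2), mul_pos (pow_pos ha 2) (pow_pos hb 2)]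
  have hδ0 : 0 ≤ δ := hd ▸ Real.sqrt_nonneg _
  have hδ : δ ^ 2 = a ^ 4 - a ^ 2 * b ^ 2 + b ^ 4 := by rw [hd, Real.sq_sqrt hrad]
  obtain ⟨A, B⟩ := ec_core a b x1 y1 x2 y2 x3 y3 s₁ s₂ s₃ hb hab o1 o2 o3 d12 d13 d23 p1 p2 p3
    (by rw [q1]; ring) (by rw [q2]; ring) (by rw [q3]; ring) R1 (by linarith)
    δ _ _ hδ0 hδ rfl rfl
  rw [← hL] at A B
  have hα : 0 < δ - b ^ 2 := by
    have := lt_of_pow_lt_pow_left₀ (a := b ^ 2) (b := δ) 2 hδ0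
      (by linarith [mul_pos (pow_pos ha 2) hc])
    linarith
  have hβ : 0 < a ^ 2 - δ := by
    have := lt_of_pow_lt_pow_left₀ (a := δ) (b := a ^ 2) 2 (by positivity)
      (by linarith [mul_pos (pow_pos hb 2) hc])
    linarith
  have A' : a * x2 + (L / 2 - s₃) / s₁ * (a * x3 - a * x2) =
      -((a * (δ - b ^ 2) / (a ^ 2 - b ^ 2)) * x1) := by linear_combination a * A
  have B' : b * y2 + (L / 2 - s₃) / s₁ * (b * y3 - b * y2) =
      -((b * (a ^ 2 - δ) / (a ^ 2 - b ^ 2)) * y1) := by linear_combination b * B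
  rw [A', B', neg_sq, neg_sq, mul_pow, mul_pow,
    mul_div_cancel_left₀ _ (by positivity), mul_div_cancel_left₀ _ (by positivity)]
  exact o1

lemma ec_cyc (a b : ℝ) (P₁ P₂ P₃ : Pt) (h : IsOrbit a b P₁ P₂ P₃) : IsOrbit a b P₂ P₃ P₁ := by
  obtain ⟨n12, n23, n13, o1, o2, o3, r1, r2, r3⟩ := h
  exact ⟨n23, n13.symm, n12.symm, o2, o3, o1, r2, r3, r1⟩

/-- The extouch points of every 3-periodic orbit lie on the confocal caustic. -/
theorem extouch_on_caustic (a b : ℝ) (hb : 0 < b) (hab : b < a)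
    (P₁ P₂ P₃ : Pt) (h : IsOrbit a b P₁ P₂ P₃) :
    let s₁ := ‖P₃ - P₂‖
    let s₂ := ‖P₁ - P₃‖
    let s₃ := ‖P₂ - P₁‖
    let L := s₁ + s₂ + s₃
    let Q₁ : Pt := P₂ + ((L / 2 - s₃) / s₁) • (P₃ - P₂)
    let Q₂ : Pt := P₃ + ((L / 2 - s₁) / s₂) • (P₁ - P₃)
    let Q₃ : Pt := P₁ + ((L / 2 - s₂) / s₃) • (P₂ - P₁)
    let δ := Real.sqrt (a ^ 4 - a ^ 2 * b ^ 2 + b ^ 4)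
    let ac := a * (δ - b ^ 2) / (a ^ 2 - b ^ 2)
    let bc := b * (a ^ 2 - δ) / (a ^ 2 - b ^ 2)
    ((Q₁ 0) ^ 2 / ac ^ 2 + (Q₁ 1) ^ 2 / bc ^ 2 = 1) ∧
    ((Q₂ 0) ^ 2 / ac ^ 2 + (Q₂ 1) ^ 2 / bc ^ 2 = 1) ∧
    ((Q₃ 0) ^ 2 / ac ^ 2 + (Q₃ 1) ^ 2 / bc ^ 2 = 1) := by
  intro s₁ s₂ s₃ L Q₁ Q₂ Q₃ δ ac bc
  have h' := ec_cyc _ _ _ _ _ h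
  have h'' := ec_cyc _ _ _ _ _ h'
  exact ⟨ec_one a b hb hab P₁ P₂ P₃ h s₁ s₂ s₃ L δ rfl rfl rfl rfl rfl,
    ec_one a b hb hab P₂ P₃ P₁ h' s₂ s₃ s₁ L δ rfl rfl rfl (by simp only [L]; ring) rfl,
    ec_one a b hb hab P₃ P₁ P₂ h'' s₃ s₁ s₂ L δ rfl rfl rfl (by simp only [L]; ring) rfl⟩
end
end

section
/- For every 3-periodic billiard orbit P₁P₂P₃ in the ellipse E, the ratio of the area of the confocal caustic ellipse (semiaxes a_c = a(δ − b²)/c², b_c = b(a² − δ)/c²) to the area of the billiard ellipse equals r/(2R): (π·a_c·b_c)/(π·a·b) = r/(2R), where r and R are the inradius and circumradius of the orbit triangle. -/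
noncomputable section

open EuclideanGeometry Real

lemma cb_core (x y x2 y2 x3 y3 p q : ℝ) (h1 : x^2+y^2=1) (h2 : x2^2+y2^2=1) (h3 : x3^2+y3^2=1)
    (e12 : (1-q)*(x*x2)+(1+q)*(y*y2) = 1-p) (e13 : (1-q)*(x*x3)+(1+q)*(y*y3) = 1-p)
    (e23 : (1-q)*(x2*x3)+(1+q)*(y2*y3) = 1-p) (hq : 0 < q) (hqp : q < p)
    (hne : x2 - x3 ≠ 0 ∨ y2 - y3 ≠ 0) :
    3 - 2*p - q^2 = 0 ∧ (x*x2+y*y2) + (x2*x3+y2*y3) + (x*x3+y*y3) = -p := by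
  obtain ⟨m, hm⟩ : ∃ m, m = (1-q)*x := ⟨_, rfl⟩
  obtain ⟨n, hn⟩ : ∃ n, n = (1+q)*y := ⟨_, rfl⟩
  have f12 : m*x2+n*y2 = 1-p := by rw [hm, hn]; linarith
  have f13 : m*x3+n*y3 = 1-p := by rw [hm, hn]; linarith
  obtain ⟨N, hN⟩ : ∃ N, N = m^2+n^2 := ⟨_, rfl⟩
  have hN0 : N ≠ 0 := by
    intro h0
    have hm0 : m = 0 := by nlinarith [sq_nonneg m, sq_nonneg n]
    have hn0 : n = 0 := by nlinarith [sq_nonneg m, sq_nonneg n]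
    have hp : p = 1 := by rw [hm0, hn0] at f12; linarith
    have hy : y = 0 := by
      rw [hn0] at hn
      rcases mul_eq_zero.mp hn.symm with h | h
      · linarith
      · exact h
    have hx : x ≠ 0 := by rintro rfl; rw [hy] at h1; norm_num at h1
    have : 1 - q = 0 := by
      rw [hm0] at hm
      exact (mul_eq_zero.mp hm.symm).resolve_right hx
    linarith
  have hT : m*(x2-x3)+n*(y2-y3) = 0 := by linarith
  have hST : (x2+x3)*(x2-x3)+(y2+y3)*(y2-y3) = 0 := by linarith
  have hcr : m*(y2+y3) - n*(x2+x3) = 0 := by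
    rcases hne with h | h
    · apply (mul_eq_zero.mp _).resolve_left h
      linear_combination (y2+y3)*hT - n*hST
    · apply (mul_eq_zero.mp _).resolve_left h
      linear_combination -(x2+x3)*hT + m*hST
  obtain ⟨μ, hμ⟩ : ∃ μ, μ = 2*(1-p)/N := ⟨_, rfl⟩
  have hμN : μ*N = 2*(1-p) := by rw [hμ]; field_simp
  obtain ⟨τ, hτ⟩ : ∃ τ, τ = (m*(y2-y3)-n*(x2-x3))/N := ⟨_, rfl⟩
  have hτN : τ*N = m*(y2-y3)-n*(x2-x3) := by rw [hτ]; field_simp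
  have sx : x2+x3 = μ*m := by
    apply mul_right_cancel₀ hN0
    linear_combination (x2+x3)*hN - n*hcr + m*(f12+f13) - m*hμN
  have sy : y2+y3 = μ*n := by
    apply mul_right_cancel₀ hN0
    linear_combination (y2+y3)*hN + m*hcr + n*(f12+f13) - n*hμN
  have tx : x2-x3 = -τ*n := by
    apply mul_right_cancel₀ hN0
    linear_combination (x2-x3)*hN + n*hτN + m*hT
  have ty : y2-y3 = τ*m := by
    apply mul_right_cancel₀ hN0
    linear_combination (y2-y3)*hN - m*hτN + n*hT
  have X2 : x2 = (μ*m-τ*n)/2 := by linarith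
  have X3 : x3 = (μ*m+τ*n)/2 := by linarith
  have Y2 : y2 = (μ*n+τ*m)/2 := by linarith
  have Y3 : y3 = (μ*n-τ*m)/2 := by linarith
  have hμτ : (μ^2+τ^2)*N = 4 := by
    rw [X2, Y2] at h2; rw [X3,Y3] at h3; rw [hN]; linarith
  obtain ⟨e, he⟩ : ∃ e, e = (1-q)*x^2+(1+q)*y^2 := ⟨_, rfl⟩
  have hNe : N = 2*e-(1-q^2) := by
    rw [hN, hm, hn, he]; linear_combination -(1-q^2)*h1
  obtain ⟨d, hd⟩ : ∃ d, d = (1-q)*m^2+(1+q)*n^2 := ⟨_, rfl⟩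
  have hde : d = 2*N-(1-q^2)*e := by
    rw [hd, hN, hm, hn, he]; ring
  have E : μ^2*d - τ^2*(2*N-d) = 4*(1-p) := by
    rw [X2, X3, Y2, Y3] at e23; rw [hd, hN]; linarith
  have hE : N*(1-p) = 2*(1-p)^2 - 2*N + d := by
    have : 4*N*(N*(1-p)) = 4*N*(2*(1-p)^2 - 2*N + d) := by
      linear_combination (-N^2)*E + (-N*(2*N-d))*hμτ + 2*N*(μ*N+2*(1-p))*hμN
    exact mul_left_cancel₀ (mul_ne_zero four_ne_zero hN0) this
  have key : (e-(1-p))*(3-2*p-q^2) = 0 := by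
    rw [hde] at hE
    rw [hNe] at hE
    linear_combination hE
  have hpos : e - (1-p) > 0 := by
    have h5 : e = 1 - q + 2*(q*y^2) := by rw [he]; linear_combination (1-q)*h1
    have h6 : 0 ≤ q*y^2 := by positivity
    linarith
  have k0 : 3-2*p-q^2 = 0 := (mul_eq_zero.mp key).resolve_left hpos.ne'
  refine ⟨k0, ?_⟩
  have s1 : x*x2+y*y2+(x*x3+y*y3) = μ*e := by
    have : x*x2+y*y2+(x*x3+y*y3) = x*(x2+x3)+y*(y2+y3) := by ring
    rw [this, sx, sy, hm, hn, he]; ring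
  have s2 : x2*x3+y2*y3 = μ^2*N/2 - 1 := by
    have : (x2+x3)^2+(y2+y3)^2 = μ^2*N := by rw [sx, sy, hN]; ring
    linarith
  have goalN : μ*e + (μ^2*N/2-1) = -p := by
    apply mul_right_cancel₀ hN0
    rw [show (μ*e + (μ^2*N/2-1))*N = (μ*N)*e+(μ*N)^2/2-N by ring, hμN, hNe]
    linear_combination (1-p) * k0
  linarith

lemma cb_reflect (a b X Y X2 Y2 X3 Y3 s t : ℝ) (ha : 0 < a) (hb : 0 < b) (hs : 0 < s) (ht : 0 < t)
    (hs2 : s^2 = a^2*(X2-X)^2+b^2*(Y2-Y)^2) (ht2 : t^2 = a^2*(X3-X)^2+b^2*(Y3-Y)^2)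
    (c1 : X^2+Y^2=1) (p2 : 0 < 1-X*X2-Y*Y2) (p3 : 0 < 1-X*X3-Y*Y3)
    (h : (s⁻¹*(a*X2-a*X)+t⁻¹*(a*X3-a*X))*(-(b*Y)/b^2)
      + (s⁻¹*(b*Y2-b*Y)+t⁻¹*(b*Y3-b*Y))*((a*X)/a^2) = 0) :
    (1-X*X2-Y*Y2)/s = (1-X*X3-Y*Y3)/t := by
  obtain ⟨α, hα⟩ : ∃ α, α = -Y*a/b*(X2-X)+X*b/a*(Y2-Y) := ⟨_, rfl⟩
  obtain ⟨β, hβ⟩ : ∃ β, β = -Y*a/b*(X3-X)+X*b/a*(Y3-Y) := ⟨_, rfl⟩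
  have h' : α/s + β/t = 0 := by
    rw [hα, hβ, ← h]; field_simp; ring
  have A1 : (X^2/a^2+Y^2/b^2)*s^2 = (1-X*X2-Y*Y2)^2 + α^2 := by
    rw [hs2, hα, show 1-X*X2-Y*Y2 = X*(X-X2)+Y*(Y-Y2) by linear_combination -c1]
    field_simp; ring
  have A2 : (X^2/a^2+Y^2/b^2)*t^2 = (1-X*X3-Y*Y3)^2 + β^2 := by
    rw [ht2, hβ, show 1-X*X3-Y*Y3 = X*(X-X3)+Y*(Y-Y3) by linear_combination -c1]
    field_simp; ring
  have B1 : ((1-X*X2-Y*Y2)/s)^2 = (X^2/a^2+Y^2/b^2) - (α/s)^2 := by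
    rw [div_pow, div_pow, ← sub_eq_zero]
    have : (1-X*X2-Y*Y2)^2 = (X^2/a^2+Y^2/b^2)*s^2 - α^2 := by linarith
    rw [this, sub_div, mul_div_assoc, div_self (by positivity)]; ring
  have B2 : ((1-X*X3-Y*Y3)/t)^2 = (X^2/a^2+Y^2/b^2) - (β/t)^2 := by
    rw [div_pow, div_pow, ← sub_eq_zero]
    have : (1-X*X3-Y*Y3)^2 = (X^2/a^2+Y^2/b^2)*t^2 - β^2 := by linarith
    rw [this, sub_div, mul_div_assoc, div_self (by positivity)]; ring
  have : α/s = -(β/t) := by linarith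
  rw [this, neg_sq, ← B2] at B1
  exact (pow_left_inj₀ (by positivity) (by positivity) two_ne_zero).mp B1

lemma cb_pos (x y x2 y2 : ℝ) (h1 : x^2+y^2=1) (h2 : x2^2+y2^2=1) (hne : x - x2 ≠ 0 ∨ y - y2 ≠ 0) :
    0 < 1 - x*x2-y*y2 := by
  have : 0 < (x-x2)^2+(y-y2)^2 := by
    rcases hne with h | h
    · have := sq_pos_of_ne_zero h; positivity
    · have := sq_pos_of_ne_zero h; positivity
  nlinarith

lemma cb_pair (a b J s x y x2 y2 : ℝ) (h1 : x^2+y^2=1) (h2 : x2^2+y2^2=1)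
    (hp : 0 < 1 - x*x2-y*y2) (hs : s^2 = a^2*(x2-x)^2+b^2*(y2-y)^2) (hJ : 1-x*x2-y*y2 = J*s) :
    (1-J^2*(a^2-b^2))*(x*x2)+(1+J^2*(a^2-b^2))*(y*y2) = 1-J^2*(a^2+b^2) := by
  apply mul_left_cancel₀ hp.ne'
  have e1 : (x2-x)^2 = (1-x*x2-y*y2)*(1-x*x2+y*y2) := by
    linear_combination y2^2*h1 + (1-x^2)*h2
  have e2 : (y2-y)^2 = (1-x*x2-y*y2)*(1+x*x2-y*y2) := by
    linear_combination x2^2*h1 + (1-y^2)*h2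
  rw [e1, e2] at hs
  have : (1-x*x2-y*y2)^2 = J^2*s^2 := by rw [hJ]; ring
  rw [hs] at this
  linear_combination -this

lemma cb_main (a b x1 y1 x2 y2 x3 y3 s1 s2 s3 J δ: ℝ) (hb : 0 < b) (hab : b < a)
    (h1 : x1^2+y1^2=1) (h2 : x2^2+y2^2=1) (h3 : x3^2+y3^2=1)
    (hs1 : s1^2 = a^2*(x3-x2)^2+b^2*(y3-y2)^2) (hs2 : s2^2 = a^2*(x1-x3)^2+b^2*(y1-y3)^2)
    (hs3 : s3^2 = a^2*(x2-x1)^2+b^2*(y2-y1)^2)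
    (p1 : 0 < s1) (p2 : 0 < s2) (p3 : 0 < s3) (hJ : 0 < J)
    (j1 : 1-x2*x3-y2*y3 = J*s1) (j2 : 1-x3*x1-y3*y1 = J*s2) (j3 : 1-x1*x2-y1*y2 = J*s3)
    (hne : x2 - x3 ≠ 0 ∨ y2 - y3 ≠ 0) (hδ0 : 0 ≤ δ) (hδ : δ^2 = a^4-a^2*b^2+b^4) :
    (δ-b^2)*(a^2-δ)/(a^2-b^2)^2 =
      (a*b*((x2-x1)*(y3-y1)-(y2-y1)*(x3-x1)))^2/((s1+s2+s3)*(s1*s2*s3)) := by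
  have ha : 0 < a := hb.trans hab
  have hc : 0 < a^2-b^2 := by nlinarith
  have e1 := cb_pair a b J s1 x2 y2 x3 y3 h2 h3 (by rw [j1]; positivity) hs1 j1
  have e2 := cb_pair a b J s2 x3 y3 x1 y1 h3 h1 (by rw [j2]; positivity) hs2 j2
  have e3 := cb_pair a b J s3 x1 y1 x2 y2 h1 h2 (by rw [j3]; positivity) hs3 j3
  have hJ2 : 0 < J^2 := by positivity
  obtain ⟨k0, hS⟩ := cb_core x1 y1 x2 y2 x3 y3 (J^2*(a^2+b^2)) (J^2*(a^2-b^2)) h1 h2 h3 e3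
    (by linarith) e1 (by positivity) (by nlinarith [mul_pos hJ2 (pow_pos hb 2)]) hne
  have hL : J*(s1+s2+s3) = 3 + J^2*(a^2+b^2) := by linarith
  have hD : ((x2-x1)*(y3-y1)-(y2-y1)*(x3-x1))^2 = 2*(J^3*(s1*s2*s3)) := by
    have : 2*(J^3*(s1*s2*s3)) = 2*((1-x2*x3-y2*y3)*(1-x3*x1-y3*y1)*(1-x1*x2-y1*y2)) := by
      rw [j1, j2, j3]; ring
    rw [this]
    obtain ⟨g1, hg1⟩ : ∃ g, g = x1^2+y1^2-1 := ⟨_, rfl⟩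
    obtain ⟨g2, hg2⟩ : ∃ g, g = x2^2+y2^2-1 := ⟨_, rfl⟩
    obtain ⟨g3, hg3⟩ : ∃ g, g = x3^2+y3^2-1 := ⟨_, rfl⟩
    have G : ((x2-x1)*(y3-y1)-(y2-y1)*(x3-x1))^2 = 
      -(g1*g2*g3 - 2*((1-x2*x3-y2*y3)*(1-x3*x1-y3*y1)*(1-x1*x2-y1*y2))
        - g1*(1-x2*x3-y2*y3)^2 - g2*(1-x3*x1-y3*y1)^2 - g3*(1-x1*x2-y1*y2)^2) := by
      rw [hg1, hg2, hg3]; ring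
    rw [G, show g1 = 0 by linarith, show g2 = 0 by linarith, show g3 = 0 by linarith]; ring
  have hk : J^2*(a^2-b^2)^2 = 2*δ-(a^2+b^2) := by
    have : J^2*(a^2-b^2)^2 + (a^2+b^2) = 2*δ := by
      apply (pow_left_inj₀ (by positivity) (by positivity) two_ne_zero).mp
      linear_combination -(a^2-b^2)^2*k0 - 4*hδ
    linarith
  rw [mul_pow, hD, div_eq_div_iff (by positivity) (by positivity)]
  suffices H : (δ-b^2)*(a^2-δ)*(J*(s1+s2+s3)) = 2*(a*b)^2*J^4*(a^2-b^2)^2 by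
    apply mul_left_cancel₀ hJ.ne'
    linear_combination (s1*s2*s3)*H
  rw [hL]
  have hd : 3 + J^2*(a^2+b^2) = 2*J^2*(δ+a^2+b^2) := by linear_combination k0 + J^2*hk
  rw [hd]
  linear_combination (-2*J^2*(a*b)^2)*hk - 2*J^2*δ*hδ

/-- The caustic-to-billiard area ratio equals r/(2R). -/
theorem caustic_billiard_area_ratio (a b : ℝ) (hb : 0 < b) (hab : b < a)
    (P₁ P₂ P₃ : Pt) (h : IsOrbit a b P₁ P₂ P₃) :
    let s₁ := ‖P₃ - P₂‖
    let s₂ := ‖P₁ - P₃‖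
    let s₃ := ‖P₂ - P₁‖
    let L := s₁ + s₂ + s₃
    let A := |((P₂ - P₁) 0) * ((P₃ - P₁) 1) - ((P₂ - P₁) 1) * ((P₃ - P₁) 0)| / 2
    let r := 2 * A / L
    let R := s₁ * s₂ * s₃ / (4 * A)
    let δ := Real.sqrt (a ^ 4 - a ^ 2 * b ^ 2 + b ^ 4)
    let ac := a * (δ - b ^ 2) / (a ^ 2 - b ^ 2)
    let bc := b * (a ^ 2 - δ) / (a ^ 2 - b ^ 2)
    (Real.pi * ac * bc) / (Real.pi * a * b) = r / (2 * R) := by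
  intro s₁ s₂ s₃ L A r R δ ac bc
  have ha : 0 < a := hb.trans hab
  have hc : 0 < a^2-b^2 := by nlinarith
  obtain ⟨n12, n23, n13, o1, o2, o3, r1, r2, r3⟩ := h
  have co : ∀ P : Pt, ∃ x y : ℝ, P 0 = a*x ∧ P 1 = b*y := fun P =>
    ⟨P 0 / a, P 1 / b, by field_simp, by field_simp⟩
  obtain ⟨x1, y1, X1, Y1⟩ := co P₁
  obtain ⟨x2, y2, X2, Y2⟩ := co P₂
  obtain ⟨x3, y3, X3, Y3⟩ := co P₃
  have nrm : ∀ (P Q : Pt) (x y x' y' : ℝ), P 0 = a*x → P 1 = b*y → Q 0 = a*x' → Q 1 = b*y' →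
      ‖Q - P‖^2 = a^2*(x'-x)^2+b^2*(y'-y)^2 := by
    intro P Q x y x' y' h1 h2 h3 h4
    rw [EuclideanSpace.norm_sq_eq]
    simp [Fin.sum_univ_two, h1, h2, h3, h4]
    ring
  have circ : ∀ (P : Pt) (x y : ℝ), P 0 = a*x → P 1 = b*y → onEllipse a b P → x^2+y^2=1 := by
    intro P x y h1 h2 h
    unfold onEllipse at h
    rw [h1, h2] at h
    rw [← h]; field_simp
  have dst : ∀ (P Q : Pt) (x y x' y' : ℝ), P 0 = a*x → P 1 = b*y → Q 0 = a*x' → Q 1 = b*y' →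
      P ≠ Q → x - x' ≠ 0 ∨ y - y' ≠ 0 := by
    intro P Q x y x' y' h1 h2 h3 h4 hne
    by_contra! hh
    apply hne
    ext i
    fin_cases i
    · simp [h1, h3]; left; linarith [hh.1]
    · simp [h2, h4]; left; linarith [hh.2]
  have c1 := circ _ _ _ X1 Y1 o1
  have c2 := circ _ _ _ X2 Y2 o2
  have c3 := circ _ _ _ X3 Y3 o3
  have d12 := dst _ _ _ _ _ _ X1 Y1 X2 Y2 n12
  have d23 := dst _ _ _ _ _ _ X2 Y2 X3 Y3 n23
  have d31 := dst _ _ _ _ _ _ X3 Y3 X1 Y1 n13.symm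
  have q12 := cb_pos _ _ _ _ c1 c2 d12
  have q23 := cb_pos _ _ _ _ c2 c3 d23
  have q31 := cb_pos _ _ _ _ c3 c1 d31
  have q21 : 0 < 1-x2*x1-y2*y1 := by linarith
  have q32 : 0 < 1-x3*x2-y3*y2 := by linarith
  have q13 : 0 < 1-x1*x3-y1*y3 := by linarith
  have hs1 : s₁^2 = _ := nrm P₂ P₃ _ _ _ _ X2 Y2 X3 Y3
  have hs2 : s₂^2 = _ := nrm P₃ P₁ _ _ _ _ X3 Y3 X1 Y1
  have hs3 : s₃^2 = _ := nrm P₁ P₂ _ _ _ _ X1 Y1 X2 Y2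
  have p1 : 0 < s₁ := norm_pos_iff.mpr (sub_ne_zero.mpr n23.symm)
  have p2 : 0 < s₂ := norm_pos_iff.mpr (sub_ne_zero.mpr n13)
  have p3 : 0 < s₃ := norm_pos_iff.mpr (sub_ne_zero.mpr n12.symm)
  have J1 : (1-x1*x2-y1*y2)/s₃ = (1-x1*x3-y1*y3)/s₂ := by
    refine cb_reflect a b x1 y1 x2 y2 x3 y3 s₃ s₂ ha hb p3 p2 hs3 (by rw [hs2]; ring) c1 q12 q13 ?_
    unfold reflects at r1
    rw [norm_sub_rev P₃ P₁] at r1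
    simpa [X1, X2, X3, Y1, Y2, Y3] using r1
  have J2 : (1-x2*x3-y2*y3)/s₁ = (1-x2*x1-y2*y1)/s₃ := by
    refine cb_reflect a b x2 y2 x3 y3 x1 y1 s₁ s₃ ha hb p1 p3 hs1 (by rw [hs3]; ring) c2 q23 q21 ?_
    unfold reflects at r2
    rw [norm_sub_rev P₁ P₂] at r2
    simpa [X1, X2, X3, Y1, Y2, Y3] using r2
  obtain ⟨J, hJ⟩ : ∃ J, J = (1-x1*x2-y1*y2)/s₃ := ⟨_, rfl⟩
  have j3 : 1-x1*x2-y1*y2 = J*s₃ := by rw [hJ]; field_simp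
  have j2 : 1-x3*x1-y3*y1 = J*s₂ := by rw [hJ, J1]; field_simp
  have j1 : 1-x2*x3-y2*y3 = J*s₁ := by
    rw [hJ, show 1-x1*x2-y1*y2 = 1-x2*x1-y2*y1 by ring, ← J2]; field_simp
  have hJ0 : 0 < J := by rw [hJ]; positivity
  have hδ : δ^2 = a^4-a^2*b^2+b^4 := Real.sq_sqrt (by nlinarith [sq_nonneg (a^2-b^2), sq_nonneg (a*b)])
  have main := cb_main a b x1 y1 x2 y2 x3 y3 s₁ s₂ s₃ J δ hb hab c1 c2 c3 hs1 hs2 hs3 p1 p2 p3 hJ0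
    j1 j2 j3 d23 (Real.sqrt_nonneg _) hδ
  have hA : (2*A)^2 = (a*b*((x2-x1)*(y3-y1)-(y2-y1)*(x3-x1)))^2 := by
    simp only [A]
    rw [mul_div_cancel₀ _ (two_ne_zero), sq_abs]
    simp only [PiLp.sub_apply, X1, X2, X3, Y1, Y2, Y3]
    ring
  have lhs : (Real.pi * ac * bc) / (Real.pi * a * b) = (δ-b^2)*(a^2-δ)/(a^2-b^2)^2 := by
    have := Real.pi_pos
    simp only [ac, bc]
    field_simp
  have rhs : r / (2 * R) = (2*A)^2/((s₁+s₂+s₃)*(s₁*s₂*s₃)) := by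
    have hL : 0 < s₁+s₂+s₃ := by positivity
    simp only [r, R, L]
    clear_value A
    field_simp
    ring
  rw [lhs, rhs, main, hA]
end
end

section
/- For every 3-periodic billiard orbit P₁P₂P₃ in the ellipse E, the radius of the cosine circle (second Lemoine circle) of its excentral triangle is the same and equals r* = (a² − b²)/√(2δ − a² − b²); equivalently, with s′₁, s′₂, s′₃ the side lengths of the excentral triangle, s′₁·s′₂·s′₃/(s′₁² + s′₂² + s′₃²) = (a² − b²)/√(2δ − a² − b²). -/
noncomputable section

open EuclideanGeometry Real

lemma cay_field (z w v m K : ℂ) (hwv : w ≠ v)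
    (h1 : 2*z*w - z^2 - w^2 = 2*K*z*w - m*z^2*w^2 - m)
    (h2 : 2*z*v - z^2 - v^2 = 2*K*z*v - m*z^2*v^2 - m)
    (h3 : 2*w*v - w^2 - v^2 = 2*K*w*v - m*w^2*v^2 - m) :
    (m^2 + 2*K - 3) * (2*K*z^2 - m - m*z^4) = 0 := by
  have hS : (w+v)*(1-m*z^2) = 2*z*(1-K) := by
    have : (w - v) * ((w+v)*(1-m*z^2) - 2*z*(1-K)) = 0 := by
      linear_combination h2 - h1
    rcases mul_eq_zero.1 this with h | h
    · exact absurd (sub_eq_zero.1 h) hwv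
    · linear_combination h
  have hP : (w*v)*(1-m*z^2) = z^2 - m := by
    linear_combination w*hS + h1
  have h3' : (w+v)^2 - 4*(w*v) + (2*K*(w*v) - m*(w*v)^2 - m) = 0 := by
    linear_combination -h3
  generalize w + v = S at *
  generalize w * v = P at *
  have e : (2*z*(1-K))^2 - 4*(z^2-m)*(1-m*z^2) + (2*K*(z^2-m)*(1-m*z^2) - m*(z^2-m)^2
      - m*(1-m*z^2)^2) = 0 := by
    rw [← hS, ← hP]
    linear_combination (1-m*z^2)^2 * h3'
  linear_combination e

lemma rel_complex (a b k p q r s : ℝ) (h1 : p^2+q^2=1) (h2 : r^2+s^2=1)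
    (hne : 0 < (p-r)^2+(q-s)^2)
    (h : ((p-r)^2+(q-s)^2)^2 = 4*k*(a^2*(p-r)^2+b^2*(q-s)^2)) (z w : ℂ)
    (hz : z = p + q * Complex.I) (hw : w = r + s * Complex.I) :
    2*z*w - z^2 - w^2 = 2*(k*(a^2+b^2) : ℝ)*z*w - (k*(a^2-b^2) : ℝ)*z^2*w^2
      - (k*(a^2-b^2) : ℝ) := by
  obtain ⟨Z, hZ⟩ : ∃ Z : ℂ, Z = p - q * Complex.I := ⟨_, rfl⟩
  obtain ⟨W, hW⟩ : ∃ W : ℂ, W = r - s * Complex.I := ⟨_, rfl⟩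
  have I2 := Complex.I_sq
  have h1' : (p:ℂ)^2+(q:ℂ)^2 = 1 := by exact_mod_cast h1
  have h2' : (r:ℂ)^2+(s:ℂ)^2 = 1 := by exact_mod_cast h2
  have zZ : z * Z = 1 := by rw [hz, hZ]; linear_combination h1' - (q:ℂ)^2 * I2
  have wW : w * W = 1 := by rw [hw, hW]; linear_combination h2' - (s:ℂ)^2 * I2
  have eQ : (((p-r)^2+(q-s)^2 : ℝ) : ℂ) = (z-w)*(Z-W) := by
    push_cast; rw [hz, hw, hZ, hW]; linear_combination ((q:ℂ)-s)^2 * I2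
  have eS : ((4*(a^2*(p-r)^2+b^2*(q-s)^2) : ℝ) : ℂ)
      = (a:ℂ)^2*((z-w)+(Z-W))^2 - (b:ℂ)^2*((z-w)-(Z-W))^2 := by
    push_cast; rw [hz, hw, hZ, hW]; linear_combination (4*(b:ℂ)^2*((q:ℂ)-s)^2) * I2
  have hc : (((p-r)^2+(q-s)^2 : ℝ) : ℂ)^2 = k * ((4*(a^2*(p-r)^2+b^2*(q-s)^2) : ℝ) : ℂ) := by
    have : ((p-r)^2+(q-s)^2)^2 = k*(4*(a^2*(p-r)^2+b^2*(q-s)^2)) := by rw [h]; ring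
    exact_mod_cast this
  have hd0 : (z-w)*(Z-W) ≠ 0 := by
    rw [← eQ]; exact_mod_cast hne.ne'
  have hd : z - w ≠ 0 := left_ne_zero_of_mul hd0
  rw [eQ, eS] at hc
  have hzw : z*w*(Z-W) = -(z-w) := by linear_combination w*zZ - z*wW
  have key : (z-w)^2 * ((z-w)^2 - k*(a^2*(z*w-1)^2 - b^2*(z*w+1)^2)) = 0 := by
    have : ((z-w)*(z*w*(Z-W)))^2 = k*((a:ℂ)^2*(z*w*(z-w)+z*w*(Z-W))^2
        - (b:ℂ)^2*(z*w*(z-w)-z*w*(Z-W))^2) := by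
      linear_combination (z*w)^2*hc
    rw [hzw] at this
    linear_combination this
  rcases mul_eq_zero.1 key with h | h
  · exact absurd (pow_eq_zero_iff (two_ne_zero) |>.1 h) hd
  · push_cast
    linear_combination -h

lemma cay_real (a b k p q r s t u : ℝ) (hb : 0 < b) (hab : b < a) (hk : 0 < k)
    (h1 : p^2+q^2=1) (h2 : r^2+s^2=1) (h3 : t^2+u^2=1)
    (n12 : 0 < (p-r)^2+(q-s)^2) (n13 : 0 < (p-t)^2+(q-u)^2) (n23 : 0 < (r-t)^2+(s-u)^2)
    (e12 : ((p-r)^2+(q-s)^2)^2 = 4*k*(a^2*(p-r)^2+b^2*(q-s)^2))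
    (e13 : ((p-t)^2+(q-u)^2)^2 = 4*k*(a^2*(p-t)^2+b^2*(q-u)^2))
    (e23 : ((r-t)^2+(s-u)^2)^2 = 4*k*(a^2*(r-t)^2+b^2*(s-u)^2)) :
    (k*(a^2-b^2))^2 + 2*(k*(a^2+b^2)) - 3 = 0 := by
  obtain ⟨z, hz⟩ : ∃ z : ℂ, z = p + q * Complex.I := ⟨_, rfl⟩
  obtain ⟨w, hw⟩ : ∃ z : ℂ, z = r + s * Complex.I := ⟨_, rfl⟩
  obtain ⟨v, hv⟩ : ∃ z : ℂ, z = t + u * Complex.I := ⟨_, rfl⟩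
  have hwv : w ≠ v := by
    intro h
    rw [hw, hv] at h
    have h0 := congrArg Complex.re h
    have h0' := congrArg Complex.im h
    simp at h0 h0'
    rw [h0, h0'] at n23
    simp at n23
  have := cay_field z w v _ _ hwv (rel_complex a b k p q r s h1 h2 n12 e12 z w hz hw)
    (rel_complex a b k p q t u h1 h3 n13 e13 z v hz hv)
    (rel_complex a b k r s t u h2 h3 n23 e23 w v hw hv)
  rcases mul_eq_zero.1 this with h | h
  · exact_mod_cast h
  · exfalso
    obtain ⟨Z, hZ⟩ : ∃ Z : ℂ, Z = p - q * Complex.I := ⟨_, rfl⟩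
    have I2 := Complex.I_sq
    have h1' : (p:ℂ)^2+(q:ℂ)^2 = 1 := by exact_mod_cast h1
    have zZ : z * Z = 1 := by rw [hz, hZ]; linear_combination h1' - (q:ℂ)^2 * I2
    have e : 2*((k*(a^2+b^2) : ℝ):ℂ) - ((k*(a^2-b^2) : ℝ):ℂ)*(Z^2+z^2) = 0 := by
      have zZ2 : z^2 * Z^2 = 1 := by rw [← mul_pow, zZ, one_pow]
      linear_combination Z^2*h
        + (((k*(a^2-b^2) : ℝ):ℂ)*z^2 - 2*((k*(a^2+b^2) : ℝ):ℂ))*zZ2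
    have e2 : Z^2+z^2 = ((2*(p^2-q^2) : ℝ) : ℂ) := by
      push_cast; rw [hz, hZ]; linear_combination 2*(q:ℂ)^2*I2
    rw [e2] at e
    have e3 : 2*(k*(a^2+b^2)) - (k*(a^2-b^2))*(2*(p^2-q^2)) = 0 := by exact_mod_cast e
    have e4 : k * (a^2*q^2 + b^2*p^2) = 0 := by
      linear_combination e3/4 + k*(a^2+b^2)/2*h1
    have e5 : a^2*q^2 + b^2*p^2 > 0 := by
      have : b^2 < a^2 := by nlinarith
      have h6 : a^2*q^2 + b^2*p^2 = (a^2-b^2)*q^2 + b^2 := by linear_combination b^2*h1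
      rw [h6]
      have := mul_nonneg (sub_pos.2 this).le (sq_nonneg q)
      have := pow_pos hb 2
      linarith
    exact (mul_pos hk e5).ne' e4

/-- noncollinearity -/
lemma noncol (p q r s t u : ℝ)
    (h1 : p^2+q^2=1) (h2 : r^2+s^2=1) (h3 : t^2+u^2=1)
    (n12 : 0 < (p-r)^2+(q-s)^2) (n13 : 0 < (p-t)^2+(q-u)^2) (n23 : 0 < (r-t)^2+(s-u)^2) :
    (r-p)*(u-q) - (s-q)*(t-p) ≠ 0 := by
  intro hc
  have g2 : 2*(p*(r-p)+q*(s-q)) = -((p-r)^2+(q-s)^2) := by linear_combination h2 - h1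
  have g3 : 2*(p*(t-p)+q*(u-q)) = -((p-t)^2+(q-u)^2) := by linear_combination h3 - h1
  have ex : ((p-r)^2+(q-s)^2)*(t-p) = ((p-t)^2+(q-u)^2)*(r-p) := by
    linear_combination (t-p)*g2 - (r-p)*g3 + 2*q*hc
  have ey : ((p-r)^2+(q-s)^2)*(u-q) = ((p-t)^2+(q-u)^2)*(s-q) := by
    linear_combination (u-q)*g2 - (s-q)*g3 - 2*p*hc
  obtain ⟨A, hA⟩ : ∃ A, A = (p-r)^2+(q-s)^2 := ⟨_, rfl⟩
  obtain ⟨B, hB⟩ : ∃ A, A = (p-t)^2+(q-u)^2 := ⟨_, rfl⟩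
  rw [← hA, ← hB] at ex ey
  rw [← hA] at n12
  rw [← hB] at n13
  have hAB : A * B * (A - B) = 0 := by
    linear_combination (A*(t-p)+B*(r-p))*ex + (A*(u-q)+B*(s-q))*ey + A^2*hB - B^2*hA
  have : A = B := by
    rcases mul_eq_zero.1 hAB with h | h
    · exact absurd h (mul_pos n12 n13).ne'
    · linarith
  subst this
  have e1 := mul_left_cancel₀ n12.ne' ex
  have e2 := mul_left_cancel₀ n12.ne' ey
  have e1' : t = r := by linarith
  have e2' : u = s := by linarith
  rw [e1', e2'] at n23
  simp at n23

/-- one vertex: `s₃ = |P₂-P₁|`, `s₂ = |P₃-P₁|` -/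
lemma vertex (a b p q r s t u s₂ s₃ : ℝ) (ha : 0 < a) (hb : 0 < b)
    (h1 : p^2+q^2=1) (h2 : r^2+s^2=1) (h3 : t^2+u^2=1)
    (hs2 : 0 < s₂) (hs3 : 0 < s₃)
    (e2 : s₂^2 = a^2*(p-t)^2+b^2*(q-u)^2)
    (e3 : s₃^2 = a^2*(p-r)^2+b^2*(q-s)^2)
    (nc : (r-p)*(u-q) - (s-q)*(t-p) ≠ 0)
    (href : (s₂*(r-p)+s₃*(t-p))*a^2*q = (s₂*(s-q)+s₃*(u-q))*b^2*p) :
    ∃ μ, a^2*(s₂*(r-p)+s₃*(t-p)) = μ*p ∧ b^2*(s₂*(s-q)+s₃*(u-q)) = μ*q ∧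
     s₂*((p-r)^2+(q-s)^2) = s₃*((p-t)^2+(q-u)^2) := by
  obtain ⟨μ, hμ⟩ : ∃ μ, μ = a^2*(s₂*(r-p)+s₃*(t-p))*p + b^2*(s₂*(s-q)+s₃*(u-q))*q := ⟨_, rfl⟩
  have f1 : a^2*(s₂*(r-p)+s₃*(t-p)) = μ*p := by
    rw [hμ]; linear_combination q*href - a^2*(s₂*(r-p)+s₃*(t-p))*h1
  have f2 : b^2*(s₂*(s-q)+s₃*(u-q)) = μ*q := by
    rw [hμ]; linear_combination -p*href - b^2*(s₂*(s-q)+s₃*(u-q))*h1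
  refine ⟨μ, f1, f2, ?_⟩
  have hμ0 : μ ≠ 0 := by
    intro h0
    rw [h0, zero_mul] at f1 f2
    have f1' : s₂*(r-p)+s₃*(t-p) = 0 := by
      rcases mul_eq_zero.1 f1 with h | h
      · exact absurd h (by positivity)
      · exact h
    have f2' : s₂*(s-q)+s₃*(u-q) = 0 := by
      rcases mul_eq_zero.1 f2 with h | h
      · exact absurd h (by positivity)
      · exact h
    apply nc
    have : s₂ * ((r-p)*(u-q) - (s-q)*(t-p)) = 0 := by
      linear_combination (u-q)*f1' - (t-p)*f2'
    rcases mul_eq_zero.1 this with h | h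
    · exact absurd h hs2.ne'
    · exact h
  have g2 : 2*(p*(r-p)+q*(s-q)) = -((p-r)^2+(q-s)^2) := by linear_combination h2 - h1
  have g3 : 2*(p*(t-p)+q*(u-q)) = -((p-t)^2+(q-u)^2) := by linear_combination h3 - h1
  have : μ * (s₂*((p-r)^2+(q-s)^2) - s₃*((p-t)^2+(q-u)^2)) = 0 := by
    have k1 : μ*(p*(s₂*(r-p)-s₃*(t-p)) + q*(s₂*(s-q)-s₃*(u-q))) = 0 := by
      linear_combination -(s₂*(r-p)-s₃*(t-p))*f1 - (s₂*(s-q)-s₃*(u-q))*f2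
        - s₂^2*e3 + s₃^2*e2
    linear_combination -2*k1 + μ*s₂*g2 - μ*s₃*g3
  rcases mul_eq_zero.1 this with h | h
  · exact absurd h hμ0
  · linarith

lemma tri_pos (x y z w s₁ s₂ s₃ : ℝ) (hs1 : 0 < s₁) (hs2 : 0 < s₂) (hs3 : 0 < s₃)
    (e3 : s₃^2 = x^2+y^2) (e2 : s₂^2 = z^2+w^2) (e1 : s₁^2 = (x-z)^2+(y-w)^2)
    (nc : x*w-y*z ≠ 0) : 0 < -s₁+s₂+s₃ ∧ 0 < s₁-s₂+s₃ ∧ 0 < s₁+s₂-s₃ := by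
  have h : (x*z+y*w)^2 < (s₂*s₃)^2 := by
    have : 0 < (x*w-y*z)^2 := by positivity
    rw [mul_pow, e2, e3]; nlinarith
  have h' := abs_lt.1 (abs_lt_of_sq_lt_sq h (by positivity))
  obtain ⟨ha, hb⟩ := h'
  have h1 : s₁ < s₂+s₃ := by
    apply lt_of_pow_lt_pow_left₀ 2 (by positivity); nlinarith
  have h2 : |s₂-s₃| < s₁ := by
    apply abs_lt_of_sq_lt_sq _ hs1.le; nlinarith
  obtain ⟨h3, h4⟩ := abs_lt.1 h2
  refine ⟨?_, ?_, ?_⟩ <;> linarith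

lemma nsq (P Q : Pt) : ‖P - Q‖^2 = (P 0 - Q 0)^2 + (P 1 - Q 1)^2 := by
  rw [EuclideanSpace.norm_sq_eq]
  simp [Fin.sum_univ_two]

/-- squared excentral side through vertex 1, in coordinates -/
lemma exc_sq (x₁ y₁ x₂ y₂ x₃ y₃ s₁ s₂ s₃ : ℝ)
    (e1 : s₁^2 = (x₃-x₂)^2+(y₃-y₂)^2) (e2 : s₂^2 = (x₁-x₃)^2+(y₁-y₃)^2)
    (e3 : s₃^2 = (x₂-x₁)^2+(y₂-y₁)^2) (hY : 0 < s₁-s₂+s₃) (hZ : 0 < s₁+s₂-s₃) :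
    ((s₁+s₂-s₃)⁻¹*(s₁*x₁+s₂*x₂+(-s₃)*x₃) - (s₁-s₂+s₃)⁻¹*(s₁*x₁+(-s₂)*x₂+s₃*x₃))^2 +
    ((s₁+s₂-s₃)⁻¹*(s₁*y₁+s₂*y₂+(-s₃)*y₃) - (s₁-s₂+s₃)⁻¹*(s₁*y₁+(-s₂)*y₂+s₃*y₃))^2
     = 4*s₁^2*s₂*s₃/((s₁-s₂+s₃)*(s₁+s₂-s₃)) := by
  have key : ∀ x₁ x₂ x₃ : ℝ, (s₁+s₂-s₃)⁻¹*(s₁*x₁+s₂*x₂+(-s₃)*x₃)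
      - (s₁-s₂+s₃)⁻¹*(s₁*x₁+(-s₂)*x₂+s₃*x₃)
      = 2*s₁*(s₂*(x₂-x₁)-s₃*(x₃-x₁))/((s₁-s₂+s₃)*(s₁+s₂-s₃)) := by
    intro x₁ x₂ x₃
    field_simp
    ring
  rw [key, key, div_pow, div_pow, ← add_div, div_eq_div_iff (by positivity) (by positivity)]
  have : (s₂*(x₂-x₁)-s₃*(x₃-x₁))^2 + (s₂*(y₂-y₁)-s₃*(y₃-y₁))^2
     = s₂*s₃*((s₁-s₂+s₃)*(s₁+s₂-s₃)) := by
    linear_combination -s₂^2*e3 - s₃^2*e2 - s₂*s₃*(e1 - e2 - e3)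
  linear_combination 4*s₁^2*((s₁-s₂+s₃)*(s₁+s₂-s₃))*this

lemma sq_pos_aux (a b x y c : ℝ) (hc : 0 < c) (h : c^2 = a^2*x^2+b^2*y^2) : 0 < x^2+y^2 := by
  by_contra hn
  have hx : x = 0 := by nlinarith [sq_nonneg x, sq_nonneg y]
  have hy : y = 0 := by nlinarith [sq_nonneg x, sq_nonneg y]
  rw [hx, hy] at h
  nlinarith

lemma ell_aux (a b x y : ℝ) (ha : 0 < a) (hb : 0 < b)
    (h : (a*x)^2/a^2 + (b*y)^2/b^2 = 1) : x^2+y^2=1 := by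
  rw [← h]; field_simp

lemma ref_alg (a b p q r s t u s₂ s₃ : ℝ) (ha : 0 < a) (hb : 0 < b) (hs2 : 0 < s₂) (hs3 : 0 < s₃)
    (h : (s₃⁻¹*(a*r-a*p)+s₂⁻¹*(a*t-a*p))*(-(b*q)/b^2)
       + (s₃⁻¹*(b*s-b*q)+s₂⁻¹*(b*u-b*q))*((a*p)/a^2) = 0) :
    (s₂*(r-p)+s₃*(t-p))*a^2*q = (s₂*(s-q)+s₃*(u-q))*b^2*p := by
  field_simp at h
  linear_combination -h

lemma final_ratio (s₁ s₂ s₃ t₁ t₂ t₃ J : ℝ) (hs1 : 0 < s₁) (hs2 : 0 < s₂) (hs3 : 0 < s₃)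
    (ht1 : 0 ≤ t₁) (ht2 : 0 ≤ t₂) (ht3 : 0 ≤ t₃)
    (hX : 0 < -s₁+s₂+s₃) (hY : 0 < s₁-s₂+s₃) (hZ : 0 < s₁+s₂-s₃) (hJ : 0 < J)
    (e1 : t₁^2 = 4*s₁^2*s₂*s₃/((s₁-s₂+s₃)*(s₁+s₂-s₃)))
    (e2 : t₂^2 = 4*s₂^2*s₃*s₁/((s₁+s₂-s₃)*(-s₁+s₂+s₃)))
    (e3 : t₃^2 = 4*s₃^2*s₁*s₂/((-s₁+s₂+s₃)*(s₁-s₂+s₃)))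
    (hh : s₁*(-s₁+s₂+s₃)+s₂*(s₁-s₂+s₃)+s₃*(s₁+s₂-s₃) = 2*J*s₁*s₂*s₃) :
    t₁*t₂*t₃/(t₁^2+t₂^2+t₃^2) = 1/J := by
  generalize -s₁+s₂+s₃ = X at *
  generalize s₁-s₂+s₃ = Y at *
  generalize s₁+s₂-s₃ = Z at *
  have prod : t₁*t₂*t₃ = 8*(s₁*s₂*s₃)^2/(X*Y*Z) := by
    rw [← sq_eq_sq₀ (by positivity) (by positivity), mul_pow, mul_pow, e1, e2, e3]
    field_simp
    ring
  have sum : t₁^2+t₂^2+t₃^2 = 4*(s₁*s₂*s₃)*(2*J*s₁*s₂*s₃)/(X*Y*Z) := by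
    rw [e1, e2, e3, ← hh]
    field_simp
  rw [prod, sum]
  field_simp
  norm_num

set_option maxHeartbeats 1000000

/-- The radius of the cosine circle of the excentral triangle is invariant. -/
theorem excentral_cosine_circle_radius (a b : ℝ) (hb : 0 < b) (hab : b < a)
    (P₁ P₂ P₃ : Pt) (h : IsOrbit a b P₁ P₂ P₃) :
    let s₁ := ‖P₃ - P₂‖
    let s₂ := ‖P₁ - P₃‖
    let s₃ := ‖P₂ - P₁‖
    let E₁ : Pt := (-s₁ + s₂ + s₃)⁻¹ • ((-s₁) • P₁ + s₂ • P₂ + s₃ • P₃)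
    let E₂ : Pt := (s₁ - s₂ + s₃)⁻¹ • (s₁ • P₁ + (-s₂) • P₂ + s₃ • P₃)
    let E₃ : Pt := (s₁ + s₂ - s₃)⁻¹ • (s₁ • P₁ + s₂ • P₂ + (-s₃) • P₃)
    let t₁ := ‖E₃ - E₂‖
    let t₂ := ‖E₁ - E₃‖
    let t₃ := ‖E₂ - E₁‖
    t₁ * t₂ * t₃ / (t₁ ^ 2 + t₂ ^ 2 + t₃ ^ 2) =
      (a ^ 2 - b ^ 2) /
        Real.sqrt (2 * Real.sqrt (a ^ 4 - a ^ 2 * b ^ 2 + b ^ 4) - a ^ 2 - b ^ 2) := by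
  intro s₁ s₂ s₃ E₁ E₂ E₃ t₁ t₂ t₃
  obtain ⟨n12, n23, n13, o1, o2, o3, r1, r2, r3⟩ := h
  have ha : 0 < a := hb.trans hab
  have hs1 : 0 < s₁ := norm_pos_iff.2 (sub_ne_zero.2 n23.symm)
  have hs2 : 0 < s₂ := norm_pos_iff.2 (sub_ne_zero.2 n13)
  have hs3 : 0 < s₃ := norm_pos_iff.2 (sub_ne_zero.2 n12.symm)
  have q1 : s₁^2 = _ := nsq P₃ P₂
  have q2 : s₂^2 = _ := nsq P₁ P₃
  have q3 : s₃^2 = _ := nsq P₂ P₁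
  have w1 : t₁^2 = _ := nsq E₃ E₂
  have w2 : t₂^2 = _ := nsq E₁ E₃
  have w3 : t₃^2 = _ := nsq E₂ E₁
  have ht1 : 0 ≤ t₁ := norm_nonneg _
  have ht2 : 0 ≤ t₂ := norm_nonneg _
  have ht3 : 0 ≤ t₃ := norm_nonneg _
  unfold reflects at r1 r2 r3
  rw [norm_sub_rev P₃ P₁] at r1
  rw [norm_sub_rev P₁ P₂] at r2
  rw [norm_sub_rev P₂ P₃] at r3
  change (s₃⁻¹ • _ + s₂⁻¹ • _ : Pt) 0 * _ + (s₃⁻¹ • _ + s₂⁻¹ • _ : Pt) 1 * _ = 0 at r1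
  change (s₁⁻¹ • _ + s₃⁻¹ • _ : Pt) 0 * _ + (s₁⁻¹ • _ + s₃⁻¹ • _ : Pt) 1 * _ = 0 at r2
  change (s₂⁻¹ • _ + s₁⁻¹ • _ : Pt) 0 * _ + (s₂⁻¹ • _ + s₁⁻¹ • _ : Pt) 1 * _ = 0 at r3
  unfold onEllipse at o1 o2 o3
  simp only [E₁, E₂, E₃, PiLp.add_apply, PiLp.sub_apply, PiLp.smul_apply, smul_eq_mul]
    at r1 r2 r3 w1 w2 w3
  clear_value t₁ t₂ t₃ 
  clear E₁ E₂ E₃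
  clear_value s₁ s₂ s₃
  have scale : ∀ c : ℝ, 0 < c → ∀ x : ℝ, ∃ p, x = c * p := fun c hc x =>
    ⟨x / c, by field_simp⟩
  obtain ⟨p, hp⟩ := scale a ha (P₁ 0)
  obtain ⟨q, hq⟩ := scale b hb (P₁ 1)
  obtain ⟨r, hr⟩ := scale a ha (P₂ 0)
  obtain ⟨s, hs⟩ := scale b hb (P₂ 1)
  obtain ⟨t, ht⟩ := scale a ha (P₃ 0)
  obtain ⟨u, hu⟩ := scale b hb (P₃ 1)
  rw [hp, hq] at o1
  rw [hr, hs] at o2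
  rw [ht, hu] at o3
  rw [hp, hq, hr, hs, ht, hu] at r1 r2 r3 w1 w2 w3
  rw [hr, hs, ht, hu] at q1
  rw [hp, hq, ht, hu] at q2
  rw [hp, hq, hr, hs] at q3
  clear hp hq hr hs ht hu n12 n23 n13
  have h1 : p^2+q^2=1 := ell_aux a b _ _ ha hb o1
  have h2 : r^2+s^2=1 := ell_aux a b _ _ ha hb o2
  have h3 : t^2+u^2=1 := ell_aux a b _ _ ha hb o3
  have d1 : s₁^2 = a^2*(r-t)^2+b^2*(s-u)^2 := by rw [q1]; ring
  have d2 : s₂^2 = a^2*(p-t)^2+b^2*(q-u)^2 := by rw [q2]; ring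
  have d3 : s₃^2 = a^2*(p-r)^2+b^2*(q-s)^2 := by rw [q3]; ring
  have m1 := sq_pos_aux a b _ _ _ hs1 d1
  have m2 := sq_pos_aux a b _ _ _ hs2 d2
  have m3 := sq_pos_aux a b _ _ _ hs3 d3
  have nc := noncol p q r s t u h1 h2 h3 m3 m2 m1
  obtain ⟨hX, hY, hZ⟩ := tri_pos (a*(r-p)) (b*(s-q)) (a*(t-p)) (b*(u-q)) s₁ s₂ s₃ hs1 hs2 hs3
    (by rw [d3]; ring) (by rw [d2]; ring) (by rw [d1]; ring) (by
      intro h0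
      apply nc
      have : a*b*((r-p)*(u-q) - (s-q)*(t-p)) = 0 := by linear_combination h0
      rcases mul_eq_zero.1 this with h | h
      · exact absurd h (by positivity)
      · exact h)
  obtain ⟨μ₁, f1, g1, j1⟩ := vertex a b p q r s t u s₂ s₃ ha hb h1 h2 h3 hs2 hs3 d2 d3 nc
    (ref_alg a b p q r s t u s₂ s₃ ha hb hs2 hs3 r1)
  obtain ⟨μ₂, f2, g2, j2⟩ := vertex a b r s t u p q s₃ s₁ ha hb h2 h3 h1 hs3 hs1
    (by rw [d3]; ring) d1 (fun h => nc (by linear_combination h))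
    (ref_alg a b r s t u p q s₃ s₁ ha hb hs3 hs1 r2)
  obtain ⟨μ₃, f3, g3, j3⟩ := vertex a b t u p q r s s₁ s₂ ha hb h3 h1 h2 hs1 hs2
    (by rw [d1]; ring) (by rw [d2]; ring) (fun h => nc (by linear_combination h))
    (ref_alg a b t u p q r s s₁ s₂ ha hb hs1 hs2 r3)
  obtain ⟨J, hJ⟩ : ∃ J, J = ((p-r)^2+(q-s)^2)/(2*s₃) := ⟨_, rfl⟩
  have hJ0 : 0 < J := by rw [hJ]; positivity
  have J3 : (p-r)^2+(q-s)^2 = 2*J*s₃ := by rw [hJ]; field_simp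
  have J2 : (p-t)^2+(q-u)^2 = 2*J*s₂ := by
    apply mul_left_cancel₀ hs3.ne'
    rw [← j1, J3]; ring
  have J1 : (r-t)^2+(s-u)^2 = 2*J*s₁ := by
    apply mul_left_cancel₀ hs3.ne'
    rw [j2]
    linear_combination s₁*J3
  have cay := cay_real a b (J^2) p q r s t u hb hab (by positivity) h1 h2 h3 m3 m2 m1
    (by rw [J3, ← d3]; ring) (by rw [J2, ← d2]; ring) (by rw [J1, ← d1]; ring)
  -- cosine relations
  have c1 : (s₁+s₂+s₃)*(-s₁+s₂+s₃) = -2*μ₁*J := by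
    have : s₃*((s₁+s₂+s₃)*(-s₁+s₂+s₃)) = s₃*(-2*μ₁*J) := by
      linear_combination 2*(r-p)*f1 + 2*(s-q)*g1 + μ₁*(h2 - h1) - μ₁*J3
        + 2*s₂*d3 + s₃*(d2+d3-d1)
    exact mul_left_cancel₀ hs3.ne' this
  have c2 : (s₁+s₂+s₃)*(s₁-s₂+s₃) = -2*μ₂*J := by
    have : s₁*((s₁+s₂+s₃)*(s₁-s₂+s₃)) = s₁*(-2*μ₂*J) := by
      linear_combination 2*(t-r)*f2 + 2*(u-s)*g2 + μ₂*(h3 - h2) - μ₂*J1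
        + 2*s₃*d1 + s₁*(d3+d1-d2)
    exact mul_left_cancel₀ hs1.ne' this
  have c3 : (s₁+s₂+s₃)*(s₁+s₂-s₃) = -2*μ₃*J := by
    have : s₂*((s₁+s₂+s₃)*(s₁+s₂-s₃)) = s₂*(-2*μ₃*J) := by
      linear_combination 2*(p-t)*f3 + 2*(q-u)*g3 + μ₃*(h1 - h3) - μ₃*J2
        + 2*s₁*d2 + s₂*(d1+d2-d3)
    exact mul_left_cancel₀ hs2.ne' this
  have hμ : s₁*μ₁+s₂*μ₂+s₃*μ₃ = -(s₁*s₂*s₃*(s₁+s₂+s₃)) := by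
    linear_combination -s₁*μ₁*h1 - s₂*μ₂*h2 - s₃*μ₃*h3 - s₁*(p*f1+q*g1) - s₂*(r*f2+s*g2)
      - s₃*(t*f3+u*g3) + s₂*s₃*d1 + s₁*s₃*d2 + s₁*s₂*d3
  have hh : s₁*(-s₁+s₂+s₃)+s₂*(s₁-s₂+s₃)+s₃*(s₁+s₂-s₃) = 2*J*s₁*s₂*s₃ := by
    apply mul_left_cancel₀ (show s₁+s₂+s₃ ≠ 0 by positivity)
    linear_combination s₁*c1+s₂*c2+s₃*c3 - 2*J*hμ
  have e1 : t₁^2 = 4*s₁^2*s₂*s₃/((s₁-s₂+s₃)*(s₁+s₂-s₃)) :=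
    w1.trans (exc_sq _ _ _ _ _ _ _ _ _ q1 q2 q3 hY hZ)
  have e2 : t₂^2 = 4*s₂^2*s₃*s₁/((s₁+s₂-s₃)*(-s₁+s₂+s₃)) := by
    have := exc_sq (a*r) (b*s) (a*t) (b*u) (a*p) (b*q) s₂ s₃ s₁ q2 q3 q1
      (by linarith only [hX, hY, hZ]) (by linarith only [hX, hY, hZ])
    rw [w2, show s₁+s₂-s₃ = s₂-s₃+s₁ by ring, show -s₁+s₂+s₃ = s₂+s₃-s₁ by ring, ← this]
    ring
  have e3 : t₃^2 = 4*s₃^2*s₁*s₂/((-s₁+s₂+s₃)*(s₁-s₂+s₃)) := by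
    have := exc_sq (a*t) (b*u) (a*p) (b*q) (a*r) (b*s) s₃ s₁ s₂ q3 q1 q2
      (by linarith only [hX, hY, hZ]) (by linarith only [hX, hY, hZ])
    rw [w3, show s₁-s₂+s₃ = s₃+s₁-s₂ by ring, show -s₁+s₂+s₃ = s₃-s₁+s₂ by ring, ← this]
    ring
  rw [final_ratio s₁ s₂ s₃ t₁ t₂ t₃ J hs1 hs2 hs3 ht1 ht2 ht3 hX hY hZ hJ0 e1 e2 e3 hh]
  have hc : 0 < a^2-b^2 := by nlinarith only [hb, hab]
  have hδ : √(a ^ 4 - a ^ 2 * b ^ 2 + b ^ 4) = (J^2*(a^2-b^2)^2 + a^2+b^2)/2 := by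
    have e : a ^ 4 - a ^ 2 * b ^ 2 + b ^ 4 = ((J^2*(a^2-b^2)^2 + a^2+b^2)/2)^2 := by
      linear_combination -(a^2-b^2)^2/4*cay
    rw [e, Real.sqrt_sq (by positivity)]
  have : 2 * √(a ^ 4 - a ^ 2 * b ^ 2 + b ^ 4) - a ^ 2 - b ^ 2 = (J*(a^2-b^2))^2 := by
    rw [hδ]; ring
  rw [this, Real.sqrt_sq (by positivity)]
  field_simp
end
end
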